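/- arXiv:2511.14915 — 2 statements merged into one kernel-verified Lean document; each statement's English description precedes it below -/
import Mathlib

section
/- Let N ≥ 2 and let H be an H-matrix. The following are equivalent: (i) for every d ≥ 1, every nonexpansive T : ℝ^d → ℝ^d with a fixed point y⋆, and every y₀ ∈ ℝ^d, the iterates of the H-matrix algorithm satisfy ‖y_{N−1} − T y_{N−1}‖² ≤ 4‖y₀ − y⋆‖²/N²; (ii) P(N−1,m;H) = (1/N)·C(N,m+1) for all m = 1,…,N−1, and λ*_{k,j}(H) ≥ 0 for all 1 ≤ j < k ≤ N. -/
open Finset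

/-- `Pinv H k m` is `P(k,m;H)`: the sum over all index sequences
`1 ≤ j(1) ≤ i(1) < j(2) ≤ i(2) < ⋯ < j(m) ≤ i(m) ≤ k` of `∏_{r} h_{i(r),j(r)}`,
with `P(k,0;H) = 1`. -/
noncomputable def Pinv (H : ℕ → ℕ → ℝ) (k : ℕ) : ℕ → ℝ
  | 0 => 1
  | m + 1 =>
    ∑ f : Fin (m + 1) → Fin (k + 1) × Fin (k + 1),
      if (∀ r, 1 ≤ ((f r).2 : ℕ) ∧ ((f r).2 : ℕ) ≤ ((f r).1 : ℕ)) ∧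
          (∀ r : Fin m, ((f r.castSucc).1 : ℕ) < ((f r.succ).2 : ℕ)) then
        ∏ r, H ((f r).1 : ℕ) ((f r).2 : ℕ)
      else 0

/-- `Qinv H k m j` is `Q(k,m,j;H)`: the partial sum of `P(k,m;H)` over those index
sequences with `j(1) = j` (zero if no such sequence exists, and zero for `m = 0`). -/
noncomputable def Qinv (H : ℕ → ℕ → ℝ) (k : ℕ) : ℕ → ℕ → ℝ
  | 0, _ => 0
  | m + 1, j =>
    ∑ f : Fin (m + 1) → Fin (k + 1) × Fin (k + 1),
      if (∀ r, 1 ≤ ((f r).2 : ℕ) ∧ ((f r).2 : ℕ) ≤ ((f r).1 : ℕ)) ∧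
          (∀ r : Fin m, ((f r.castSucc).1 : ℕ) < ((f r.succ).2 : ℕ)) ∧
          ((f 0).2 : ℕ) = j then
        ∏ r, H ((f r).1 : ℕ) ((f r).2 : ℕ)
      else 0

/-- The H-certificates `λ*_{k,j}(H)`:
`λ*_{N,j}(H) = N·Σ_{m=1}^{N−j} (−1)^{m−1}·Q(N−1,m,j;H)` for `j = 1,…,N−1`, and
`λ*_{k,j}(H) = N·Σ_{ℓ=1}^{N−j} Σ_{m=1}^{N−k} (−1)^{ℓ+m−1}·C(ℓ+m,m)·Q(N−1,ℓ,j;H)·Q(N−1,m,k;H)`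
for `1 ≤ j < k ≤ N−1`. -/
noncomputable def lamStar (N : ℕ) (H : ℕ → ℕ → ℝ) (k j : ℕ) : ℝ :=
  if k = N then
    (N : ℝ) * ∑ m ∈ Finset.Icc 1 (N - j), (-1 : ℝ) ^ (m - 1) * Qinv H (N - 1) m j
  else
    (N : ℝ) * ∑ l ∈ Finset.Icc 1 (N - j), ∑ m ∈ Finset.Icc 1 (N - k),
      (-1 : ℝ) ^ (l + m - 1) * (Nat.choose (l + m) m : ℝ) *
        Qinv H (N - 1) l j * Qinv H (N - 1) m k

section Kirszbraun

variable {ι E F : Type*} [NormedAddCommGroup E] [InnerProductSpace ℝ E]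
  [NormedAddCommGroup F] [InnerProductSpace ℝ F]

theorem sum_sum_mul_norm_sub_sq [Fintype ι] (c : ι → ℝ) (hc : ∑ i, c i = 1) (q : ι → F) :
    ∑ i, ∑ j, c i * c j * ‖q i - q j‖ ^ 2 =
      2 * (∑ i, c i * ‖q i‖ ^ 2 - ‖∑ i, c i • q i‖ ^ 2) := by
  have h1 : ‖∑ i, c i • q i‖ ^ 2 = ∑ i, ∑ j, c i * c j * inner ℝ (q i) (q j) := by
    rw [← real_inner_self_eq_norm_sq, sum_inner]
    refine sum_congr rfl fun i _ => ?_
    rw [inner_sum]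
    refine sum_congr rfl fun j _ => ?_
    rw [real_inner_smul_left, real_inner_smul_right]
    ring
  have h2 : ∑ i, ∑ j, c i * c j * ‖q i‖ ^ 2 = ∑ i, c i * ‖q i‖ ^ 2 := by
    refine sum_congr rfl fun i _ => ?_
    calc ∑ j, c i * c j * ‖q i‖ ^ 2 = (∑ j, c j) * (c i * ‖q i‖ ^ 2) := by
          rw [sum_mul]; exact sum_congr rfl fun j _ => by ring
      _ = c i * ‖q i‖ ^ 2 := by rw [hc, one_mul]
  have h3 : ∑ i, ∑ j, c i * c j * ‖q j‖ ^ 2 = ∑ i, c i * ‖q i‖ ^ 2 := by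
    rw [sum_comm, ← h2]
    exact sum_congr rfl fun i _ => sum_congr rfl fun j _ => by ring
  calc ∑ i, ∑ j, c i * c j * ‖q i - q j‖ ^ 2
      = ∑ i, ∑ j, (c i * c j * ‖q i‖ ^ 2 + c i * c j * ‖q j‖ ^ 2
          - 2 * (c i * c j * inner ℝ (q i) (q j))) := by
        refine sum_congr rfl fun i _ => sum_congr rfl fun j _ => ?_
        rw [norm_sub_sq_real]; ring
    _ = _ := by
        simp only [sum_sub_distrib, sum_add_distrib, ← mul_sum]
        rw [h1, h2, h3]; ring

/-- One-point extension of a nonexpansive map defined on a finite family. -/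
theorem exists_norm_sub_le_of_nonexpansive [Fintype ι] [Nonempty ι] (p : ι → E) (q : ι → F)
    (h : ∀ i j, ‖q i - q j‖ ≤ ‖p i - p j‖) (x : E) :
    ∃ z : F, ∀ i, ‖z - q i‖ ≤ ‖x - p i‖ := by
  classical
  set a : ι → ℝ := fun i => ‖q i‖ ^ 2 - ‖p i - x‖ ^ 2 with ha
  set g : (ι → ℝ) → ℝ := fun c => ∑ i, c i * a i - ‖∑ i, c i • q i‖ ^ 2 with hg
  have hgc : Continuous g := by fun_prop
  obtain ⟨c, hcmem, hcmax⟩ := (isCompact_stdSimplex ℝ ι).exists_isMaxOn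
    ⟨_, single_mem_stdSimplex ℝ (Classical.arbitrary ι)⟩ hgc.continuousOn
  set z := ∑ i, c i • q i with hz
  have hgle : g c ≤ 0 := by
    have e1 := sum_sum_mul_norm_sub_sq c hcmem.2 q
    have e2 := sum_sum_mul_norm_sub_sq c hcmem.2 fun i => p i - x
    have e3 : ∑ i, ∑ j, c i * c j * ‖q i - q j‖ ^ 2 ≤
        ∑ i, ∑ j, c i * c j * ‖(p i - x) - (p j - x)‖ ^ 2 := by
      refine sum_le_sum fun i _ => sum_le_sum fun j _ => ?_
      rw [sub_sub_sub_cancel_right]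
      have := h i j
      have := mul_nonneg (hcmem.1 i) (hcmem.1 j)
      gcongr
    have e4 : g c = ∑ i, c i * ‖q i‖ ^ 2 - ∑ i, c i * ‖p i - x‖ ^ 2 - ‖z‖ ^ 2 := by
      simp only [hg, ha, mul_sub, sum_sub_distrib]; rfl
    nlinarith [sq_nonneg ‖∑ i, c i • (p i - x)‖]
  refine ⟨z, fun i => ?_⟩
  have key : ∀ t : ℝ, 0 < t → t ≤ 1 →
      ‖z - q i‖ ^ 2 - ‖p i - x‖ ^ 2 - g c ≤ t * ‖q i - z‖ ^ 2 := by
    intro t ht0 ht1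
    have hmem : (1 - t) • c + t • Pi.single i (1 : ℝ) ∈ stdSimplex ℝ ι :=
      convex_stdSimplex ℝ ι hcmem (single_mem_stdSimplex ℝ i) (by linarith) ht0.le (by ring)
    have hle : g ((1 - t) • c + t • Pi.single i (1 : ℝ)) ≤ g c := hcmax hmem
    have e1 : ∑ k, ((1 - t) • c + t • Pi.single i (1 : ℝ) : ι → ℝ) k • q k = z + t • (q i - z) := by
      simp only [Pi.add_apply, Pi.smul_apply, smul_eq_mul, add_smul, sum_add_distrib, mul_smul,
        ← smul_sum, Pi.single_apply, ite_smul, one_smul, zero_smul, sum_ite_eq', mem_univ, if_true]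
      rw [← hz]; module
    have e2 : ∑ k, ((1 - t) • c + t • Pi.single i (1 : ℝ) : ι → ℝ) k * a k =
        (1 - t) * ∑ k, c k * a k + t * a i := by
      simp only [Pi.add_apply, Pi.smul_apply, smul_eq_mul, add_mul, sum_add_distrib, mul_assoc,
        ← mul_sum, Pi.single_apply, ite_mul, one_mul, zero_mul, sum_ite_eq', mem_univ, if_true]
    simp only [hg] at hle ⊢
    rw [e1, e2, ← hz, norm_add_sq_real, norm_smul, real_inner_smul_right, inner_sub_right,
      real_inner_self_eq_norm_sq, Real.norm_of_nonneg ht0.le] at hle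
    have e3 : ‖z - q i‖ ^ 2 = ‖z‖ ^ 2 - 2 * inner ℝ z (q i) + ‖q i‖ ^ 2 := norm_sub_sq_real _ _
    rw [e3]
    refine le_of_mul_le_mul_left ?_ ht0
    simp only [ha] at hle ⊢
    rw [← hz]
    nlinarith
  have hlim : ‖z - q i‖ ^ 2 - ‖p i - x‖ ^ 2 - g c ≤ 0 := by
    by_contra! hpos
    set s := ‖z - q i‖ ^ 2 - ‖p i - x‖ ^ 2 - g c
    set K := ‖q i - z‖ ^ 2
    have hK : 0 ≤ K := sq_nonneg _
    have := key (s / (2 * (s + K))) (by positivity)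
      (by rw [div_le_one (by positivity)]; linarith)
    rw [div_mul_eq_mul_div, le_div_iff₀ (by positivity)] at this
    nlinarith
  rw [norm_sub_rev x]
  exact le_of_sq_le_sq (by linarith) (norm_nonneg _)

/-- Kirszbraun's theorem for a finite family: nonexpansive maps on a finite family of points
extend to the whole space. -/
theorem exists_nonexpansive_extension [Finite ι] [Nonempty ι] [ProperSpace F]
    (p : ι → E) (q : ι → F) (h : ∀ i j, ‖q i - q j‖ ≤ ‖p i - p j‖) :
    ∃ T : E → F, (∀ x y, ‖T x - T y‖ ≤ ‖x - y‖) ∧ ∀ i, T (p i) = q i := by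
  classical
  have := Fintype.ofFinite ι
  let i₀ : ι := Classical.arbitrary ι
  have hfin : ∀ s : Finset E, ∃ T : E → F, (∀ i, T (p i) = q i) ∧
      (∀ x, ‖T x - q i₀‖ ≤ ‖x - p i₀‖) ∧ (∀ x ∈ s, ∀ i, ‖T x - q i‖ ≤ ‖x - p i‖) ∧
      ∀ x ∈ s, ∀ y ∈ s, ‖T x - T y‖ ≤ ‖x - y‖ := by
    intro s
    induction s using Finset.induction_on with
    | empty =>
      refine ⟨fun x => if hx : ∃ i, p i = x then q hx.choose else q i₀, fun i => ?_, fun x => ?_,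
        by simp, by simp⟩
      · have hx : ∃ k, p k = p i := ⟨i, rfl⟩
        have h1 := h hx.choose i
        rw [hx.choose_spec, sub_self, norm_zero] at h1
        simp only [hx, dif_pos]
        exact sub_eq_zero.1 (norm_le_zero_iff.1 h1)
      · by_cases hx : ∃ i, p i = x
        · have h1 := h hx.choose i₀
          rw [hx.choose_spec] at h1
          simpa [hx] using h1
        · simp [hx]
    | insert x s hxs ih =>
      obtain ⟨T, hTp, hT₀, hTs, hTT⟩ := ih
      by_cases hx : ∃ i, p i = x
      · obtain ⟨k, rfl⟩ := hx
        refine ⟨T, hTp, hT₀, fun y hy i => ?_, fun y hy y' hy' => ?_⟩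
        · rcases mem_insert.1 hy with rfl | hy
          · rw [hTp]; exact h _ _
          · exact hTs y hy i
        · rcases mem_insert.1 hy with rfl | hy <;> rcases mem_insert.1 hy' with rfl | hy'
          · simp
          · rw [norm_sub_rev, norm_sub_rev (p k), hTp]; exact hTs _ hy' _
          · rw [hTp]; exact hTs _ hy _
          · exact hTT _ hy _ hy'
      · obtain ⟨z, hz⟩ := exists_norm_sub_le_of_nonexpansive
          (Sum.elim p (fun y : s => (y : E))) (Sum.elim q (fun y : s => T y)) (by
            rintro (i | i) (j | j)
            · exact h i j
            · simp only [Sum.elim_inl, Sum.elim_inr]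
              rw [norm_sub_rev, norm_sub_rev (p i)]; exact hTs _ j.2 _
            · exact hTs _ i.2 _
            · exact hTT _ i.2 _ j.2) x
        have hzp : ∀ i, ‖z - q i‖ ≤ ‖x - p i‖ := fun i => hz (Sum.inl i)
        have hzs : ∀ y ∈ s, ‖z - T y‖ ≤ ‖x - y‖ := fun y hy => hz (Sum.inr ⟨y, hy⟩)
        have hne : ∀ y ∈ s, Function.update T x z y = T y := fun y hy =>
          Function.update_of_ne (by rintro rfl; exact hxs hy) _ _
        refine ⟨Function.update T x z, fun i => ?_, fun y => ?_, fun y hy i => ?_,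
          fun y hy y' hy' => ?_⟩
        · rw [Function.update_of_ne (fun hi => hx ⟨i, hi⟩), hTp]
        · by_cases hy : y = x
          · subst hy; simpa using hzp i₀
          · rw [Function.update_of_ne hy]; exact hT₀ y
        · rcases mem_insert.1 hy with rfl | hy
          · simpa using hzp i
          · rw [hne y hy]; exact hTs y hy i
        · rcases mem_insert.1 hy with hyx | hy <;> rcases mem_insert.1 hy' with hyx' | hy'
          · simp [hyx, hyx']
          · rw [hne y' hy', hyx, Function.update_self]; exact hzs y' hy'
          · rw [hne y hy, hyx', Function.update_self, norm_sub_rev, norm_sub_rev y]; exact hzs y hy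
          · rw [hne y hy, hne y' hy']; exact hTT _ hy _ hy'
  have hK : IsCompact (Set.pi Set.univ fun x : E => Metric.closedBall (q i₀) ‖x - p i₀‖) :=
    isCompact_univ_pi fun x => isCompact_closedBall _ _
  have hcl : ∀ xy : E × E, IsClosed {T : E → F | (∀ i, T (p i) = q i) ∧
      ‖T xy.1 - T xy.2‖ ≤ ‖xy.1 - xy.2‖} := by
    intro xy
    rw [show {T : E → F | (∀ i, T (p i) = q i) ∧ ‖T xy.1 - T xy.2‖ ≤ ‖xy.1 - xy.2‖} =
      (⋂ i, {T | T (p i) = q i}) ∩ {T | ‖T xy.1 - T xy.2‖ ≤ ‖xy.1 - xy.2‖} by ext; simp]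
    exact (isClosed_iInter fun i => isClosed_eq (continuous_apply _) continuous_const).inter
      (isClosed_le (by fun_prop) continuous_const)
  obtain ⟨T, -, hT⟩ := hK.inter_iInter_nonempty _ hcl fun u => by
    obtain ⟨T, hTp, hT₀, -, hTT⟩ := hfin (u.image Prod.fst ∪ u.image Prod.snd)
    refine ⟨T, fun x _ => ?_, Set.mem_iInter₂.2 fun xy hxy => ⟨hTp, hTT _ ?_ _ ?_⟩⟩
    · rw [mem_closedBall_iff_norm]; exact hT₀ x
    · exact mem_union_left _ (mem_image_of_mem _ hxy)
    · exact mem_union_right _ (mem_image_of_mem _ hxy)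
  rw [Set.mem_iInter] at hT
  exact ⟨T, fun x y => (hT (x, y)).2, (hT (0, 0)).1⟩

end Kirszbraun

section Combinatorics

/-- Recursive description of `Q(n,m,j;H)`, with `j` shifted by one and extended to `m = 0` by the
indicator of `j = n`. -/
noncomputable def certWeight (H : ℕ → ℕ → ℝ) (n : ℕ) : ℕ → ℕ → ℝ
  | 0, k => if k = n then 1 else 0
  | l + 1, j => ∑ i ∈ Ico j n, H (i + 1) (j + 1) * ∑ k ∈ Ico (i + 1) (n + 1), certWeight H n l k

variable (H : ℕ → ℕ → ℝ) (n : ℕ)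

/-- Admissible index sequences for `Pinv` and `Qinv`. -/
def IsIndexChain {k m : ℕ} (f : Fin (m + 1) → Fin (k + 1) × Fin (k + 1)) : Prop :=
  (∀ r, 1 ≤ ((f r).2 : ℕ) ∧ ((f r).2 : ℕ) ≤ ((f r).1 : ℕ)) ∧
    ∀ r : Fin m, ((f r.castSucc).1 : ℕ) < ((f r.succ).2 : ℕ)

theorem isChain'_cons {k m : ℕ} (a : Fin (k + 1) × Fin (k + 1))
    (f : Fin (m + 1) → Fin (k + 1) × Fin (k + 1)) :
    IsIndexChain (Fin.cons a f : Fin (m + 2) → Fin (k + 1) × Fin (k + 1)) ↔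
      (1 ≤ (a.2 : ℕ) ∧ (a.2 : ℕ) ≤ a.1) ∧ (a.1 : ℕ) < (f 0).2 ∧ IsIndexChain f := by
  simp only [IsIndexChain, Fin.forall_fin_succ (n := m + 1), Fin.cons_zero, Fin.cons_succ,
    Fin.forall_fin_succ (n := m), Fin.castSucc_zero, ← Fin.succ_castSucc]
  tauto

open Classical in
theorem Pinv_succ_eq (m : ℕ) : Pinv H n (m + 1) =
    ∑ f : Fin (m + 1) → Fin (n + 1) × Fin (n + 1),
      if IsIndexChain f then ∏ r, H (f r).1 (f r).2 else 0 := by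
  rw [Pinv]
  exact sum_congr rfl fun f _ => if_congr Iff.rfl rfl rfl

open Classical in
theorem Qinv_succ_eq (m j : ℕ) : Qinv H n (m + 1) j =
    ∑ f : Fin (m + 1) → Fin (n + 1) × Fin (n + 1),
      if IsIndexChain f ∧ ((f 0).2 : ℕ) = j then ∏ r, H (f r).1 (f r).2 else 0 := by
  simp only [Qinv, IsIndexChain, and_assoc]

open Classical in
theorem sum_isChain'_of_lt (m t : ℕ) :
    (∑ f : Fin (m + 1) → Fin (n + 1) × Fin (n + 1),
      if IsIndexChain f ∧ t < ((f 0).2 : ℕ) then ∏ r, H (f r).1 (f r).2 else 0) =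
    ∑ k ∈ Ico t n, Qinv H n (m + 1) (k + 1) := by
  simp only [Qinv_succ_eq]
  rw [sum_comm]
  refine sum_congr rfl fun f _ => ?_
  by_cases hf : IsIndexChain f
  · by_cases ht : t < ((f 0).2 : ℕ)
    · have h2 := (f 0).2.isLt
      rw [if_pos ⟨hf, ht⟩, sum_eq_single_of_mem (((f 0).2 : ℕ) - 1)
        (by rw [mem_Ico]; omega), if_pos ⟨hf, by omega⟩]
      intro b _ hb
      rw [if_neg]
      rintro ⟨-, h⟩
      omega
    · rw [if_neg (fun h => ht h.2)]
      refine (sum_eq_zero fun k hk => if_neg ?_).symm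
      rintro ⟨-, h⟩
      rw [mem_Ico] at hk
      omega
  · simp [hf]

theorem Pinv_succ_eq_sum_Qinv (m : ℕ) :
    Pinv H n (m + 1) = ∑ k ∈ range n, Qinv H n (m + 1) (k + 1) := by
  classical
  rw [range_eq_Ico, ← sum_isChain'_of_lt, Pinv_succ_eq]
  refine sum_congr rfl fun f _ => ?_
  congr 1
  exact propext ⟨fun h => ⟨h, (h.1 0).1⟩, fun h => h.1⟩

theorem sum_pair_eq (F : ℕ → ℝ) (j : ℕ) :
    (∑ a : Fin (n + 1) × Fin (n + 1),
      if (1 ≤ (a.2 : ℕ) ∧ (a.2 : ℕ) ≤ a.1) ∧ (a.2 : ℕ) = j + 1 then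
        H a.1 a.2 * F a.1 else 0) = ∑ i ∈ Ico j n, H (i + 1) (j + 1) * F (i + 1) := by
  rw [Fintype.sum_prod_type, Fin.sum_univ_eq_sum_range (fun i => ∑ y : Fin (n + 1),
    if (1 ≤ (y : ℕ) ∧ (y : ℕ) ≤ i) ∧ (y : ℕ) = j + 1 then H i y * F i else 0),
    sum_range_succ']
  rw [range_eq_Ico, sum_eq_zero (s := univ), add_zero]
  · rw [← sum_subset (Ico_subset_Ico_left (Nat.zero_le j))]
    · refine sum_congr rfl fun i hi => ?_
      rw [mem_Ico] at hi
      rw [sum_eq_single_of_mem (⟨j + 1, by omega⟩ : Fin (n + 1)) (mem_univ _)]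
      · exact if_pos ⟨⟨Nat.succ_pos j, Nat.succ_le_succ hi.1⟩, rfl⟩
      · intro b _ hb
        rw [if_neg]
        rintro ⟨-, h⟩
        exact hb (Fin.ext h)
    · intro i hi hi'
      rw [mem_Ico] at hi hi'
      refine sum_eq_zero fun b _ => if_neg ?_
      rintro ⟨⟨-, h1⟩, h2⟩
      exact hi' ⟨by omega, hi.2⟩
  · intro b _
    rw [if_neg]
    rintro ⟨h1, h2⟩
    omega

theorem Qinv_one (j : ℕ) : Qinv H n 1 (j + 1) = ∑ i ∈ Ico j n, H (i + 1) (j + 1) := by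
  classical
  have := sum_pair_eq H n (fun _ => 1) j
  simp only [mul_one] at this
  rw [← this, Qinv_succ_eq, ← (Equiv.funUnique (Fin 1) (Fin (n + 1) × Fin (n + 1))).symm.sum_comp]
  refine sum_congr rfl fun a _ => ?_
  simp [IsIndexChain]

theorem Qinv_succ_succ (m j : ℕ) : Qinv H n (m + 2) (j + 1) =
    ∑ i ∈ Ico j n, H (i + 1) (j + 1) * ∑ k ∈ Ico (i + 1) n, Qinv H n (m + 1) (k + 1) := by
  classical
  simp only [← sum_isChain'_of_lt]
  rw [← sum_pair_eq H n (fun t => ∑ f : Fin (m + 1) → Fin (n + 1) × Fin (n + 1),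
    if IsIndexChain f ∧ t < ((f 0).2 : ℕ) then ∏ r, H (f r).1 (f r).2 else 0) j, Qinv_succ_eq,
    ← (Fin.consEquiv fun _ => Fin (n + 1) × Fin (n + 1)).sum_comp, Fintype.sum_prod_type]
  refine sum_congr rfl fun a _ => ?_
  simp only [Fin.consEquiv, Equiv.coe_fn_mk]
  split_ifs with ha
  · rw [mul_sum]
    refine sum_congr rfl fun f _ => ?_
    rw [mul_ite, mul_zero]
    refine if_congr ?_ ?_ rfl
    · rw [isChain'_cons, Fin.cons_zero]; tauto
    · rw [Fin.prod_univ_succ]; simp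
  · refine sum_eq_zero fun f _ => if_neg ?_
    rw [isChain'_cons, Fin.cons_zero]; tauto

theorem certWeight_succ_self (l : ℕ) : certWeight H n (l + 1) n = 0 := by
  simp [certWeight]

theorem Qinv_eq_certWeight (m j : ℕ) : Qinv H n (m + 1) (j + 1) = certWeight H n (m + 1) j := by
  induction m generalizing j with
  | zero =>
    rw [Qinv_one, certWeight]
    refine sum_congr rfl fun i hi => ?_
    rw [mem_Ico] at hi
    rw [sum_eq_single_of_mem n (by rw [mem_Ico]; omega)]
    · simp [certWeight]
    · intro b _ hb
      simp [certWeight, hb]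
  | succ m ih =>
    rw [Qinv_succ_succ, certWeight]
    refine sum_congr rfl fun i hi => ?_
    rw [mem_Ico] at hi
    rw [sum_Ico_succ_top (by omega), certWeight_succ_self, add_zero]
    simp only [ih]

theorem sum_certWeight (m : ℕ) : ∑ k ∈ range (n + 1), certWeight H n m k = Pinv H n m := by
  cases m with
  | zero => simp [certWeight, Pinv]
  | succ m =>
    rw [sum_range_succ, certWeight_succ_self, add_zero, Pinv_succ_eq_sum_Qinv]
    simp only [Qinv_eq_certWeight]

theorem certWeight_eq_zero {m j : ℕ} (h : n < m + j) : certWeight H n m j = 0 := by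
  induction m generalizing j with
  | zero =>
    rw [certWeight, if_neg (by omega)]
  | succ m ih =>
    rw [certWeight]
    refine sum_eq_zero fun i hi => ?_
    rw [mem_Ico] at hi
    rw [sum_eq_zero, mul_zero]
    intro k hk
    rw [mem_Ico] at hk
    exact ih (by omega)

theorem lamStar_eq {j k : ℕ} (hjk : j < k) (hk : k ≤ n) :
    lamStar (n + 1) H (k + 1) (j + 1) = -(((n + 1 : ℕ) : ℝ) *
      ∑ l ∈ range (n + 1), ∑ m ∈ range (n + 1), (-1) ^ (l + m) * ((l + m).choose m : ℝ) *
        certWeight H n l j * certWeight H n m k) := by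
  have hsum : ∀ (i : ℕ), i < n → ∀ F : ℕ → ℝ,
      ∑ l ∈ range (n + 1), F l * certWeight H n l i =
      ∑ l ∈ Icc 1 (n + 1 - (i + 1)), F l * Qinv H n l (i + 1) := by
    intro i hi F
    have h1 : ∑ l ∈ Icc 1 (n + 1 - (i + 1)), F l * Qinv H n l (i + 1) =
        ∑ l ∈ Icc 1 (n + 1 - (i + 1)), F l * certWeight H n l i := by
      refine sum_congr rfl fun l hl => ?_
      rw [mem_Icc] at hl
      obtain ⟨l, rfl⟩ := Nat.exists_eq_add_of_le' hl.1
      rw [Qinv_eq_certWeight]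
    rw [h1]
    refine (sum_subset (fun l hl => ?_) fun l _ hl => ?_).symm
    · rw [mem_Icc] at hl
      rw [mem_range]
      omega
    · rw [mem_Icc, not_and_or] at hl
      rcases Nat.eq_zero_or_pos l with rfl | hl0
      · rw [certWeight, if_neg hi.ne, mul_zero]
      · rw [certWeight_eq_zero _ _ (by omega), mul_zero]
  have hj : j < n := by omega
  rw [lamStar, Nat.add_sub_cancel]
  rcases hk.eq_or_lt with rfl | hkn
  · rw [if_pos rfl, ← mul_neg]
    congr 1
    have h0 : ∀ l, ∑ m ∈ range (k + 1), (-1) ^ (l + m) * ((l + m).choose m : ℝ) *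
        certWeight H k l j * certWeight H k m k = (-1) ^ l * certWeight H k l j := by
      intro l
      rw [sum_eq_single_of_mem 0 (by simp)]
      · simp [certWeight]
      · intro m _ hm
        rw [certWeight_eq_zero (j := k) _ _ (by omega), mul_zero]
    simp only [h0]
    rw [hsum j hj, ← sum_neg_distrib]
    refine sum_congr rfl fun m hm => ?_
    rw [mem_Icc] at hm
    obtain ⟨m, rfl⟩ := Nat.exists_eq_add_of_le' hm.1
    rw [Nat.add_sub_cancel]
    ring
  · rw [if_neg (by omega), ← mul_neg]
    congr 1
    have h0 : ∀ l, ∑ m ∈ range (n + 1), (-1) ^ (l + m) * ((l + m).choose m : ℝ) *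
        certWeight H n l j * certWeight H n m k = (∑ m ∈ Icc 1 (n + 1 - (k + 1)),
          (-1) ^ (l + m) * ((l + m).choose m : ℝ) * Qinv H n m (k + 1)) * certWeight H n l j := by
      intro l
      rw [← hsum k hkn fun m => (-1) ^ (l + m) * ((l + m).choose m : ℝ), sum_mul]
      exact sum_congr rfl fun m _ => by ring
    simp only [h0]
    rw [hsum j hj, ← sum_neg_distrib]
    refine sum_congr rfl fun l hl => ?_
    rw [sum_mul, ← sum_neg_distrib]
    refine sum_congr rfl fun m hm => ?_
    rw [mem_Icc] at hm hl
    obtain ⟨m, rfl⟩ := Nat.exists_eq_add_of_le' hm.1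
    rw [← add_assoc, Nat.add_sub_cancel]
    ring

end Combinatorics

section Identity

theorem choose_neg_natCast_succ (l m : ℕ) :
    Ring.choose (-((l : ℤ) + 1)) m = (-1) ^ m * ((l + m).choose m : ℤ) := by
  rw [Ring.choose_neg, show (l : ℤ) + 1 + m - 1 = ((l + m : ℕ) : ℤ) by push_cast; ring,
    Ring.choose_natCast, Int.negOnePow_def, zpow_natCast, Units.smul_def, smul_eq_mul]
  push_cast
  rfl

theorem sum_neg_one_pow_choose_mul_choose {n l : ℕ} (hl : l ≤ n) :
    ∑ m ∈ range (n + 1), (-1 : ℝ) ^ m * ((l + m).choose m : ℝ) * ((n + 1).choose (m + 1) : ℝ) =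
      if l = 0 then 1 else 0 := by
  have h := Ring.add_choose_eq (r := -((l : ℤ) + 1)) (s := ((n + 1 : ℕ) : ℤ)) n (Commute.all _ _)
  rw [show -((l : ℤ) + 1) + ((n + 1 : ℕ) : ℤ) = ((n - l : ℕ) : ℤ) by
    rw [Nat.cast_sub hl]; push_cast; ring, Ring.choose_natCast,
    Nat.sum_antidiagonal_eq_sum_range_succ
      (fun i j => Ring.choose (-((l : ℤ) + 1)) i * Ring.choose ((n + 1 : ℕ) : ℤ) j)] at h
  have h2 : ∑ m ∈ range (n + 1), (-1 : ℤ) ^ m * ((l + m).choose m : ℤ) *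
      ((n + 1).choose (m + 1) : ℤ) = ((n - l).choose n : ℕ) := by
    rw [h]
    refine sum_congr rfl fun m hm => ?_
    rw [mem_range] at hm
    rw [choose_neg_natCast_succ, Ring.choose_natCast,
      Nat.choose_symm_of_eq_add (show n + 1 = (m + 1) + (n - m) by omega)]
  have h3 : (n - l).choose n = if l = 0 then 1 else 0 := by
    split_ifs with h0
    · simp [h0]
    · exact Nat.choose_eq_zero_of_lt (by omega)
  rw [h3] at h2
  exact_mod_cast h2

theorem sum_range_sum_range_of_symm (b : ℕ → ℕ → ℝ) (hb : ∀ i j, b i j = b j i)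
    (hb0 : ∀ i, b i i = 0) (n : ℕ) :
    ∑ i ∈ range n, ∑ j ∈ range n, b i j = 2 * ∑ i ∈ range n, ∑ j ∈ range i, b i j := by
  induction n with
  | zero => simp
  | succ n ih =>
    simp only [sum_range_succ, sum_add_distrib]
    rw [ih, hb0, sum_congr rfl fun i _ => hb i n]
    ring

variable {V : Type*} [NormedAddCommGroup V] [InnerProductSpace ℝ V]

theorem sum_mul_inner_sub_eq (M : ℕ → ℕ → ℝ) (hM : ∀ i j, M i j = M j i) (x u : ℕ → V) (n : ℕ) :
    ∑ k ∈ range n, ∑ j ∈ range k, M k j * inner ℝ (x k - x j) (u k - u j) =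
      ∑ k ∈ range n, (∑ j ∈ range n, M k j) * inner ℝ (x k) (u k) -
        ∑ k ∈ range n, ∑ j ∈ range n, M k j * inner ℝ (x k) (u j) := by
  have h := sum_range_sum_range_of_symm
    (fun k j => M k j * inner ℝ (x k - x j) (u k - u j))
    (fun i j => by
      rw [hM i j, ← neg_sub (x j), ← neg_sub (u j), inner_neg_neg]) (fun i => by simp) n
  have h1 : ∑ k ∈ range n, ∑ j ∈ range n, M k j * inner ℝ (x k - x j) (u k - u j) =
      ∑ k ∈ range n, ∑ j ∈ range n, M k j * inner ℝ (x k) (u k)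
      + ∑ k ∈ range n, ∑ j ∈ range n, M k j * inner ℝ (x j) (u j)
      - ∑ k ∈ range n, ∑ j ∈ range n, M k j * inner ℝ (x k) (u j)
      - ∑ k ∈ range n, ∑ j ∈ range n, M k j * inner ℝ (x j) (u k) := by
    simp only [← sum_add_distrib, ← sum_sub_distrib]
    refine sum_congr rfl fun k _ => sum_congr rfl fun j _ => ?_
    simp only [inner_sub_left, inner_sub_right]
    ring
  have h2 : ∑ k ∈ range n, ∑ j ∈ range n, M k j * inner ℝ (x j) (u j) =
      ∑ k ∈ range n, ∑ j ∈ range n, M k j * inner ℝ (x k) (u k) := by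
    rw [sum_comm]
    exact sum_congr rfl fun k _ => sum_congr rfl fun j _ => by rw [hM]
  have h3 : ∑ k ∈ range n, ∑ j ∈ range n, M k j * inner ℝ (x j) (u k) =
      ∑ k ∈ range n, ∑ j ∈ range n, M k j * inner ℝ (x k) (u j) := by
    rw [sum_comm]
    exact sum_congr rfl fun k _ => sum_congr rfl fun j _ => by rw [hM]
  rw [h1, h2, h3] at h
  simp only [sum_mul]
  linarith

/-- Pascal's rule in the form of a telescoping double sum. -/
theorem sum_pascal_telescope (W : ℕ → ℕ → ℝ) (hW : ∀ i j, W i j = W j i) (n : ℕ)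
    (h0 : ∀ l, W (n + 1) l = 0) :
    ∑ l ∈ range (n + 1), ∑ m ∈ range (n + 1), (-1) ^ (l + m) * ((l + m).choose m : ℝ) *
      (2 * W (m + 1) l + W m l) = W 0 0 := by
  set c : ℕ → ℕ → ℝ := fun l m => (-1) ^ (l + m) * ((l + m).choose m : ℝ) with hc
  have hcs : ∀ l m, c l m = c m l := by
    intro l m
    simp only [hc]
    rw [add_comm m l, Nat.choose_symm_add]
  have shift : ∀ l, ∑ m ∈ range (n + 1), c l m * W (m + 1) l =
      ∑ m ∈ range (n + 1), (if m = 0 then 0 else c l (m - 1)) * W m l := by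
    intro l
    have h := (sum_range_succ (fun m => (if m = 0 then 0 else c l (m - 1)) * W m l) (n + 1)).symm.trans
      (sum_range_succ' _ _)
    simpa [h0] using h.symm
  have e1 : ∑ l ∈ range (n + 1), ∑ m ∈ range (n + 1), c l m * W (m + 1) l =
      ∑ l ∈ range (n + 1), ∑ m ∈ range (n + 1), (if l = 0 then 0 else c m (l - 1)) * W m l := by
    simp only [shift]
    rw [sum_comm]
    exact sum_congr rfl fun k _ => sum_congr rfl fun j _ => by rw [hW]
  have e2 : ∑ l ∈ range (n + 1), ∑ m ∈ range (n + 1), c l m * (2 * W (m + 1) l + W m l) =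
      ∑ l ∈ range (n + 1), ∑ m ∈ range (n + 1), c l m * W (m + 1) l
      + ∑ l ∈ range (n + 1), ∑ m ∈ range (n + 1), c l m * W (m + 1) l
      + ∑ l ∈ range (n + 1), ∑ m ∈ range (n + 1), c l m * W m l := by
    simp only [← sum_add_distrib]
    exact sum_congr rfl fun k _ => sum_congr rfl fun j _ => by ring
  rw [e2]
  nth_rewrite 2 [e1]
  simp only [shift, ← sum_add_distrib, ← add_mul]
  have e3 : ∀ l m, (if m = 0 then 0 else c l (m - 1)) + (if l = 0 then 0 else c m (l - 1)) + c l m =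
      if l = 0 ∧ m = 0 then 1 else 0 := by
    intro l m
    rcases l with _ | l <;> rcases m with _ | m
    · simp [hc]
    · simp [hc, pow_succ]
    · simp [hc, pow_succ]
    · simp only [hc, Nat.add_sub_cancel, Nat.succ_ne_zero, if_false, false_and]
      have e : (l + 1 + (m + 1)).choose (m + 1) =
          (l + 1 + m).choose m + (m + 1 + l).choose l := by
        rw [show l + 1 + (m + 1) = (l + 1 + m) + 1 by ring, Nat.choose_succ_succ,
          show l + 1 + m = (m + 1) + l by ring, Nat.choose_symm_add]
      rw [e]
      push_cast
      ring
  simp only [e3]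
  rw [sum_eq_single_of_mem 0 (by simp), sum_eq_single_of_mem 0 (by simp)]
  · simp
  · intro m _ hm; simp [hm]
  · intro l _ hl; simp [hl]

theorem sum_certWeight_smul (H : ℕ → ℕ → ℝ) (n l : ℕ) {W : Type*} [AddCommGroup W] [Module ℝ W]
    (y g : ℕ → W)
    (hy : ∀ k < n, y (k + 1) = y k - ∑ j ∈ range (k + 1), H (k + 1) (j + 1) • g j) :
    ∑ k ∈ range (n + 1), certWeight H n l k • y k =
      Pinv H n l • y 0 - ∑ j ∈ range (n + 1), certWeight H n (l + 1) j • g j := by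
  have hyk : ∀ k ≤ n, y k = y 0 -
      ∑ i ∈ range n, if i < k then ∑ j ∈ range (i + 1), H (i + 1) (j + 1) • g j else 0 := by
    intro k hk
    rw [← sum_filter, show filter (· < k) (range n) = range k by ext; simp; omega]
    induction k with
    | zero => simp
    | succ k ih =>
      rw [hy k (by omega), ih (by omega),
        sum_range_succ (fun i => ∑ j ∈ range (i + 1), H (i + 1) (j + 1) • g j) k]
      abel
  have h1 : ∑ k ∈ range (n + 1), certWeight H n l k • y k = ∑ k ∈ range (n + 1),
      (certWeight H n l k • y 0 - ∑ i ∈ range n, ∑ j ∈ range n,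
        if i < k ∧ j ≤ i then (certWeight H n l k * H (i + 1) (j + 1)) • g j else 0) := by
    refine sum_congr rfl fun k hk => ?_
    rw [mem_range] at hk
    rw [hyk k (by omega), smul_sub, smul_sum]
    congr 1
    refine sum_congr rfl fun i hi => ?_
    rw [mem_range] at hi
    split_ifs with hik
    · rw [smul_sum]
      simp only [hik, true_and, mul_smul]
      rw [← sum_filter]
      refine sum_congr ?_ fun _ _ => rfl
      ext j
      simp only [mem_range, mem_filter]
      omega
    · simp [hik]
  rw [h1, sum_sub_distrib, ← sum_smul, sum_certWeight, sum_range_succ (fun j =>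
    certWeight H n (l + 1) j • g j), certWeight_succ_self, zero_smul, add_zero]
  congr 1
  rw [sum_comm]
  simp only [sum_comm (s := range (n + 1))]
  rw [sum_comm]
  refine sum_congr rfl fun j hj => ?_
  rw [mem_range] at hj
  rw [certWeight, sum_smul, range_eq_Ico, ← sum_subset (Ico_subset_Ico_left (Nat.zero_le j))]
  · refine sum_congr rfl fun i hi => ?_
    rw [mem_Ico] at hi
    rw [mul_sum, sum_smul, ← sum_filter]
    refine sum_congr ?_ fun k _ => by rw [mul_comm]
    ext k
    simp only [mem_range, mem_filter, mem_Ico]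
    omega
  · intro i hi0 hi
    rw [mem_Ico] at hi hi0
    exact sum_eq_zero fun k _ => if_neg (by omega)

theorem sum_lamStar_mul_inner (H : ℕ → ℕ → ℝ) (n : ℕ)
    (hP : ∀ l ≤ n, Pinv H n l = 1 / ((n + 1 : ℕ) : ℝ) * ((n + 1).choose (l + 1) : ℝ))
    (y u : ℕ → V)
    (hy : ∀ k < n, y (k + 1) = y k - ∑ j ∈ range (k + 1), H (k + 1) (j + 1) • (2 : ℝ) • u j) :
    ∑ k ∈ range (n + 1), ∑ j ∈ range k, lamStar (n + 1) H (k + 1) (j + 1) *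
      inner ℝ ((y k - u k) - (y j - u j)) (u k - u j) =
    inner ℝ (u n) (y 0 - (y n - u n) - ((n + 1 : ℕ) : ℝ) • u n) := by
  set N : ℝ := ((n + 1 : ℕ) : ℝ) with hN
  have hN0 : N ≠ 0 := by rw [hN]; positivity
  set c : ℕ → ℕ → ℝ := fun l m => (-1) ^ (l + m) * ((l + m).choose m : ℝ) with hc
  have hcs : ∀ l m, c l m = c m l := by
    intro l m
    simp only [hc]
    rw [add_comm m l, Nat.choose_symm_add]
  set q := certWeight H n with hq
  set M : ℕ → ℕ → ℝ := fun k j =>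
    N * ∑ l ∈ range (n + 1), ∑ m ∈ range (n + 1), c l m * q l j * q m k with hM
  set U : ℕ → V := fun l => ∑ k ∈ range (n + 1), q l k • u k with hU
  set x : ℕ → V := fun k => y k - u k with hx
  have hMs : ∀ k j, M k j = M j k := by
    intro k j
    simp only [hM]
    rw [sum_comm]
    congr 1
    exact sum_congr rfl fun l _ => sum_congr rfl fun m _ => by rw [hcs]; ring
  have hU0 : U 0 = u n := by
    simp only [hU, hq, certWeight, ite_smul, one_smul, zero_smul]
    rw [sum_ite_eq' (range (n + 1)) n u, if_pos (by simp)]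
  have hUn : U (n + 1) = 0 := by
    simp only [hU, hq]
    exact sum_eq_zero fun k _ => by rw [certWeight_eq_zero _ _ (by omega), zero_smul]
  have hbin : ∀ l ≤ n, ∑ m ∈ range (n + 1), c l m * (N * Pinv H n m) = if l = 0 then 1 else 0 := by
    intro l hl
    have h := sum_neg_one_pow_choose_mul_choose hl
    have h2 : ∑ m ∈ range (n + 1), c l m * (N * Pinv H n m) = (-1) ^ l * ∑ m ∈ range (n + 1),
        (-1 : ℝ) ^ m * ((l + m).choose m : ℝ) * ((n + 1).choose (m + 1) : ℝ) := by
      rw [mul_sum]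
      refine sum_congr rfl fun m hm => ?_
      rw [hP m (by rw [mem_range] at hm; omega), ← mul_assoc N, mul_one_div_cancel hN0]
      simp only [hc]
      ring
    rw [h2, h]
    split_ifs with h0 <;> simp [h0]
  have hX : ∀ l, ∑ k ∈ range (n + 1), q l k • x k =
      Pinv H n l • y 0 - (2 : ℝ) • U (l + 1) - U l := by
    intro l
    simp only [hx, smul_sub, sum_sub_distrib]
    rw [sum_certWeight_smul H n l y (fun j => (2 : ℝ) • u j) hy]
    simp only [hU, smul_sum, smul_comm (2 : ℝ), hq]
  have hrow : ∀ k ≤ n, ∑ j ∈ range (n + 1), M k j = if k = n then 1 else 0 := by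
    intro k hk
    have h1 : ∑ j ∈ range (n + 1), M k j =
        ∑ m ∈ range (n + 1), q m k * ∑ l ∈ range (n + 1), c m l * (N * Pinv H n l) := by
      simp only [hM, ← sum_certWeight H n, mul_sum]
      rw [← sum_comm_cycle]
      conv_rhs => rw [sum_comm]
      refine sum_congr rfl fun l _ => ?_
      exact sum_congr rfl fun m _ => sum_congr rfl fun j _ => by rw [hcs l]; ring
    rw [h1, sum_congr rfl fun m hm => by
      rw [hbin m (by rw [mem_range] at hm; omega), mul_ite, mul_one, mul_zero],
      sum_ite_eq' (range (n + 1)) 0, if_pos (by simp)]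
    rfl
  have hquad : ∑ k ∈ range (n + 1), ∑ j ∈ range (n + 1), M k j * inner ℝ (x k) (u j) =
      inner ℝ (y 0) (u n) - N * inner ℝ (u n) (u n) := by
    have h1 : ∑ k ∈ range (n + 1), ∑ j ∈ range (n + 1), M k j * inner ℝ (x k) (u j) =
        ∑ l ∈ range (n + 1), ∑ m ∈ range (n + 1), N * c l m *
          inner ℝ (∑ k ∈ range (n + 1), q m k • x k) (U l) := by
      simp only [hM, mul_sum, sum_mul]
      rw [sum_comm_cycle]
      refine sum_congr rfl fun l _ => ?_
      rw [sum_comm_cycle]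
      refine sum_congr rfl fun m _ => ?_
      simp only [hU, sum_inner, inner_sum, mul_sum, real_inner_smul_left, real_inner_smul_right]
      rw [sum_comm]
      exact sum_congr rfl fun k _ => sum_congr rfl fun j _ => by ring
    have h2 : ∑ l ∈ range (n + 1), ∑ m ∈ range (n + 1), N * c l m *
          inner ℝ (∑ k ∈ range (n + 1), q m k • x k) (U l) =
        ∑ l ∈ range (n + 1), (∑ m ∈ range (n + 1), c l m * (N * Pinv H n m)) *
          inner ℝ (y 0) (U l) - N * ∑ l ∈ range (n + 1), ∑ m ∈ range (n + 1),
            c l m * (2 * inner ℝ (U (m + 1)) (U l) + inner ℝ (U m) (U l)) := by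
      rw [mul_sum, ← sum_sub_distrib]
      refine sum_congr rfl fun l _ => ?_
      rw [mul_sum, sum_mul, ← sum_sub_distrib]
      refine sum_congr rfl fun m _ => ?_
      rw [hX, inner_sub_left, inner_sub_left, real_inner_smul_left, real_inner_smul_left]
      ring
    have h3 := sum_pascal_telescope (fun i j => inner ℝ (U i) (U j))
      (fun i j => real_inner_comm _ _) n (fun l => by rw [hUn, inner_zero_left])
    rw [h1, h2, h3, sum_congr rfl fun l hl => by
      rw [hbin l (by rw [mem_range] at hl; omega), ite_mul, one_mul, zero_mul],
      sum_ite_eq' (range (n + 1)) 0, if_pos (by simp), hU0]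
  have hlam : ∑ k ∈ range (n + 1), ∑ j ∈ range k, lamStar (n + 1) H (k + 1) (j + 1) *
      inner ℝ (x k - x j) (u k - u j) =
      -∑ k ∈ range (n + 1), ∑ j ∈ range k, M k j * inner ℝ (x k - x j) (u k - u j) := by
    rw [← sum_neg_distrib]
    refine sum_congr rfl fun k hk => ?_
    rw [← sum_neg_distrib]
    refine sum_congr rfl fun j hj => ?_
    rw [mem_range] at hk hj
    rw [lamStar_eq H n hj (by omega), neg_mul]
  rw [hlam, sum_mul_inner_sub_eq M hMs, hquad, sum_congr rfl fun k hk => by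
    rw [hrow k (by rw [mem_range] at hk; omega), ite_mul, one_mul, zero_mul],
    sum_ite_eq' (range (n + 1)) n, if_pos (by simp)]
  simp only [hx, inner_sub_right, inner_sub_left, real_inner_smul_right]
  rw [real_inner_comm (u n) (y 0), real_inner_comm (u n) (y n)]
  ring

end Identity

section Reduction

/-- The bound `‖y n - T (y n)‖² ≤ 4 ‖y 0 - y⋆‖² / (n + 1)²` for all nonexpansive maps of all
Euclidean spaces. -/
def IsExactOptimal (H : ℕ → ℕ → ℝ) (n : ℕ) : Prop :=
  ∀ (d : ℕ), 1 ≤ d →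
    ∀ (T : EuclideanSpace ℝ (Fin d) → EuclideanSpace ℝ (Fin d)),
      (∀ x y, ‖T x - T y‖ ≤ ‖x - y‖) →
    ∀ (ystar : EuclideanSpace ℝ (Fin d)), T ystar = ystar →
    ∀ (y0 : EuclideanSpace ℝ (Fin d)) (y : ℕ → EuclideanSpace ℝ (Fin d)),
      y 0 = y0 →
      (∀ k, k < n →
        y (k + 1) = y k - ∑ j ∈ Finset.range (k + 1), H (k + 1) (j + 1) • (y j - T (y j))) →
      ‖y n - T (y n)‖ ^ 2 ≤ 4 * ‖y0 - ystar‖ ^ 2 / ((n + 1 : ℕ) : ℝ) ^ 2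

theorem norm_sub_two_smul_le_iff {V : Type*} [NormedAddCommGroup V] [InnerProductSpace ℝ V]
    (a b u w : V) : ‖(a - (2 : ℝ) • u) - (b - (2 : ℝ) • w)‖ ≤ ‖a - b‖ ↔
      0 ≤ inner ℝ ((a - u) - (b - w)) (u - w) := by
  rw [← sq_le_sq₀ (norm_nonneg _) (norm_nonneg _),
    show (a - (2 : ℝ) • u) - (b - (2 : ℝ) • w) = (a - b) - (2 : ℝ) • (u - w) by module,
    show (a - u) - (b - w) = (a - b) - (u - w) by abel, norm_sub_sq_real, norm_smul,
    real_inner_smul_right, inner_sub_left (a - b), real_inner_self_eq_norm_sq, mul_pow,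
    Real.norm_two]
  constructor <;> intro h <;> linarith

theorem isExactOptimal_of_lamStar_nonneg {H : ℕ → ℕ → ℝ} {n : ℕ}
    (hP : ∀ l ≤ n, Pinv H n l = 1 / ((n + 1 : ℕ) : ℝ) * ((n + 1).choose (l + 1) : ℝ))
    (hlam : ∀ k j, j < k → k ≤ n → 0 ≤ lamStar (n + 1) H (k + 1) (j + 1)) :
    IsExactOptimal H n := by
  intro d _ T hT ystar hstar y0 y hy0 hy
  set u : ℕ → EuclideanSpace ℝ (Fin d) := fun k => (1 / 2 : ℝ) • (y k - T (y k)) with hu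
  have hu2 : ∀ k, (2 : ℝ) • u k = y k - T (y k) := fun k => by simp only [hu]; module
  have hTu : ∀ k, T (y k) = y k - (2 : ℝ) • u k := fun k => by rw [hu2]; abel
  have hid := sum_lamStar_mul_inner H n hP y u (fun k hk => by simp only [hu2]; exact hy k hk)
  have hnonneg : 0 ≤ inner ℝ (u n) (y 0 - (y n - u n) - ((n + 1 : ℕ) : ℝ) • u n) := by
    rw [← hid]
    refine sum_nonneg fun k hk => sum_nonneg fun j hj => ?_
    rw [mem_range] at hk hj
    refine mul_nonneg (hlam k j hj (by omega)) ?_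
    rw [← norm_sub_two_smul_le_iff, ← hTu, ← hTu]
    exact hT _ _
  have hs : 0 ≤ inner ℝ ((y n - u n) - ystar) (u n) := by
    have h := (norm_sub_two_smul_le_iff (y n) ystar (u n) 0).1 (by
      rw [← hTu, smul_zero, sub_zero]
      nth_rewrite 1 [← hstar]
      exact hT _ _)
    simpa using h
  rw [← hu2, norm_smul, Real.norm_two, ← hy0, le_div_iff₀ (by positivity)]
  have hle : ((n + 1 : ℕ) : ℝ) * ‖u n‖ ^ 2 ≤ ‖u n‖ * ‖y 0 - ystar‖ := by
    refine le_trans ?_ (real_inner_le_norm _ _)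
    rw [← real_inner_self_eq_norm_sq]
    rw [real_inner_comm] at hs
    simp only [inner_sub_right, real_inner_smul_right] at hnonneg hs ⊢
    linarith
  have hle2 : ((n + 1 : ℕ) : ℝ) * ‖u n‖ ≤ ‖y 0 - ystar‖ := by
    rcases (norm_nonneg (u n)).eq_or_lt with h | h
    · rw [← h, mul_zero]
      exact norm_nonneg _
    · refine le_of_mul_le_mul_left ?_ h
      linarith
  have := pow_le_pow_left₀ (by positivity) hle2 2
  linarith

theorem IsExactOptimal.norm_sq_le {H : ℕ → ℕ → ℝ} {n d : ℕ} (h : IsExactOptimal H n) (hd : 1 ≤ d)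
    (y u : ℕ → EuclideanSpace ℝ (Fin d))
    (hy : ∀ k < n, y (k + 1) = y k - ∑ j ∈ range (k + 1), H (k + 1) (j + 1) • (2 : ℝ) • u j)
    (hpair : ∀ k ≤ n, ∀ j ≤ n, 0 ≤ inner ℝ ((y k - u k) - (y j - u j)) (u k - u j))
    (hstar : ∀ k ≤ n, 0 ≤ inner ℝ (y k - u k) (u k)) :
    (((n + 1 : ℕ) : ℝ) * ‖u n‖) ^ 2 ≤ ‖y 0‖ ^ 2 := by
  obtain ⟨T, hT, hTp⟩ := exists_nonexpansive_extension
    (fun i : Option (Fin (n + 1)) => i.elim (0 : EuclideanSpace ℝ (Fin d)) fun k => y k)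
    (fun i : Option (Fin (n + 1)) => i.elim (0 : EuclideanSpace ℝ (Fin d))
      fun k => y k - (2 : ℝ) • u k) (by
    have hs : ∀ k ≤ n, ‖y k - (2 : ℝ) • u k‖ ≤ ‖y k‖ := by
      intro k hk
      have := norm_sub_two_smul_le_iff (y k) 0 (u k) 0
      simp only [smul_zero, sub_zero] at this
      exact this.2 (hstar k hk)
    rintro (_ | k) (_ | j)
    · simp
    · show ‖0 - (y j - (2 : ℝ) • u j)‖ ≤ ‖0 - y j‖
      rw [zero_sub, zero_sub, norm_neg, norm_neg]
      exact hs j (by omega)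
    · simpa using hs k (by omega)
    · exact (norm_sub_two_smul_le_iff _ _ _ _).2 (hpair k (by omega) j (by omega)))
  have hTy : ∀ k ≤ n, y k - T (y k) = (2 : ℝ) • u k := by
    intro k hk
    have : T (y k) = y k - (2 : ℝ) • u k := hTp (some ⟨k, by omega⟩)
    rw [this]
    abel
  have := h d hd T hT 0 (hTp none) (y 0) y rfl (fun k hk => by
    rw [hy k hk]
    congr 1
    exact sum_congr rfl fun j hj => by rw [hTy j (by rw [mem_range] at hj; omega)])
  rw [hTy n le_rfl, norm_smul, Real.norm_two, sub_zero, le_div_iff₀ (by positivity)] at this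
  linarith

end Reduction

section Polynomials

open Polynomial

/-- The polynomials `p_0 = 1`, `p_{k+1} = p_k - ∑_{j ≤ k} h_{k+1,j+1} (1 - X) p_j`. If `T` is affine
with linear part `A`, then the residual `y_k - T y_k` of the algorithm is `p_k(A) (y_0 - T y_0)`. -/
noncomputable def residualPoly (H : ℕ → ℕ → ℝ) : ℕ → ℝ[X]
  | 0 => 1
  | k + 1 => residualPoly H k -
      ∑ j : Fin (k + 1), H (k + 1) (j + 1) • ((1 - X) * residualPoly H j)

/-- The polynomials `r_k` with `y_k = y_0 - r_k(A) (y_0 - T y_0)` for an affine map `T` with linear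
part `A`. -/
noncomputable def displacementPoly (H : ℕ → ℕ → ℝ) (k : ℕ) : ℝ[X] :=
  ∑ i ∈ range k, ∑ j ∈ range (i + 1), H (i + 1) (j + 1) • residualPoly H j

theorem residualPoly_zero (H : ℕ → ℕ → ℝ) : residualPoly H 0 = 1 := by rw [residualPoly]

theorem residualPoly_succ (H : ℕ → ℕ → ℝ) (k : ℕ) : residualPoly H (k + 1) = residualPoly H k -
    ∑ j ∈ range (k + 1), H (k + 1) (j + 1) • ((1 - X) * residualPoly H j) := by
  rw [residualPoly, Finset.sum_range]

theorem residualPoly_eq (H : ℕ → ℕ → ℝ) (k : ℕ) :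
    residualPoly H k = 1 - (1 - X) * displacementPoly H k := by
  induction k with
  | zero => simp [residualPoly_zero, displacementPoly]
  | succ k ih =>
    have h : displacementPoly H (k + 1) = displacementPoly H k +
        ∑ j ∈ range (k + 1), H (k + 1) (j + 1) • residualPoly H j := sum_range_succ _ _
    rw [residualPoly_succ, ih, h, mul_add, mul_sum, sub_sub]
    simp only [mul_smul_comm]

theorem residualPoly_mem_degreeLT (H : ℕ → ℕ → ℝ) (k : ℕ) :
    residualPoly H k ∈ degreeLT ℝ (k + 1) := by
  induction k using Nat.strong_induction_on with
  | _ k ih =>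
    rcases k with _ | k
    · rw [residualPoly_zero, mem_degreeLT]
      simp
    · rw [residualPoly_succ]
      refine Submodule.sub_mem _ (degreeLT_mono (Nat.le_succ _) (ih k (Nat.lt_succ_self k)))
        (Submodule.sum_mem _ fun j hj => Submodule.smul_mem _ _ ?_)
      rw [mem_range] at hj
      have h := ih j (by omega)
      rw [sub_mul, one_mul]
      refine Submodule.sub_mem _ (degreeLT_mono (by omega) h) ?_
      refine degreeLT_mono (show j + 1 + 1 ≤ k + 1 + 1 by omega) ?_
      rw [mem_degreeLT, degree_lt_iff_coeff_zero] at h ⊢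
      intro m hm
      obtain ⟨m, rfl⟩ : ∃ i, m = i + 1 := ⟨m - 1, by omega⟩
      rw [coeff_X_mul]
      exact h m (by omega)

theorem coeff_residualPoly_eq_zero (H : ℕ → ℕ → ℝ) {k m : ℕ} (h : k < m) :
    (residualPoly H k).coeff m = 0 := by
  have := residualPoly_mem_degreeLT H k
  rw [mem_degreeLT, degree_lt_iff_coeff_zero] at this
  exact this m h

theorem displacementPoly_mem_degreeLT (H : ℕ → ℕ → ℝ) (k : ℕ) :
    displacementPoly H k ∈ degreeLT ℝ k := by
  refine Submodule.sum_mem _ fun i hi => Submodule.sum_mem _ fun j hj => Submodule.smul_mem _ _ ?_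
  rw [mem_range] at hi hj
  exact degreeLT_mono (by omega) (residualPoly_mem_degreeLT H j)

theorem coeff_residualPoly_succ_self (H : ℕ → ℕ → ℝ) (k : ℕ) :
    (residualPoly H (k + 1)).coeff (k + 1) = H (k + 1) (k + 1) * (residualPoly H k).coeff k := by
  have hc : ∀ j, ((1 - X) * residualPoly H j).coeff (k + 1) =
      (residualPoly H j).coeff (k + 1) - (residualPoly H j).coeff k := fun j => by
    rw [sub_mul, one_mul, coeff_sub, coeff_X_mul]
  rw [residualPoly_succ, coeff_sub, coeff_residualPoly_eq_zero H (Nat.lt_succ_self k),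
    finsetSum_coeff, sum_range_succ, sum_eq_zero]
  · rw [coeff_smul, hc, coeff_residualPoly_eq_zero H (Nat.lt_succ_self k), smul_eq_mul]
    ring
  · intro j hj
    rw [mem_range] at hj
    rw [coeff_smul, hc, coeff_residualPoly_eq_zero H (show j < k + 1 by omega),
      coeff_residualPoly_eq_zero H hj, sub_zero, smul_zero]

theorem coeff_residualPoly_self_ne_zero {H : ℕ → ℕ → ℝ} {n k : ℕ} (hk : k ≤ n)
    (h : (residualPoly H n).coeff n ≠ 0) : (residualPoly H k).coeff k ≠ 0 := by
  induction n, hk using Nat.le_induction with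
  | base => exact h
  | succ n hn ih =>
    refine ih fun h0 => h ?_
    rw [coeff_residualPoly_succ_self, h0, mul_zero]

theorem exists_functional_residualPoly {H : ℕ → ℕ → ℝ} {n : ℕ}
    (h : (residualPoly H n).coeff n ≠ 0) (c : ℕ → ℝ) :
    ∃ φ : ℝ[X] →ₗ[ℝ] ℝ, ∀ k ≤ n, φ (residualPoly H k) = c k := by
  suffices ∀ m ≤ n + 1, ∃ φ : ℝ[X] →ₗ[ℝ] ℝ, ∀ k < m, φ (residualPoly H k) = c k by
    obtain ⟨φ, hφ⟩ := this (n + 1) le_rfl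
    exact ⟨φ, fun k hk => hφ k (by omega)⟩
  intro m
  induction m with
  | zero => exact fun _ => ⟨0, fun k hk => absurd hk (Nat.not_lt_zero k)⟩
  | succ m ih =>
    intro hm
    obtain ⟨φ, hφ⟩ := ih (by omega)
    have h0 := coeff_residualPoly_self_ne_zero (show m ≤ n by omega) h
    refine ⟨φ + ((c m - φ (residualPoly H m)) / (residualPoly H m).coeff m) • lcoeff ℝ m,
      fun k hk => ?_⟩
    rw [LinearMap.add_apply, LinearMap.smul_apply, lcoeff_apply, smul_eq_mul]
    rcases (Nat.lt_succ_iff.1 hk).eq_or_lt with rfl | hk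
    · rw [div_mul_cancel₀ _ h0]
      ring
    · rw [coeff_residualPoly_eq_zero H hk, hφ k hk, mul_zero, add_zero]

theorem residualPoly_eq_sum_Pinv (H : ℕ → ℕ → ℝ) (n : ℕ) :
    residualPoly H n = ∑ l ∈ range (n + 1), C (Pinv H n l) * (X - 1) ^ l := by
  set Y : ℕ → ℝ[X] := fun l => ∑ k ∈ range (n + 1), certWeight H n l k • residualPoly H k with hY
  have hstep : ∀ l, Y l = C (Pinv H n l) + (X - 1) * Y (l + 1) := by
    intro l
    simp only [hY]
    rw [sum_certWeight_smul H n l (residualPoly H) (fun j => (1 - X) * residualPoly H j)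
      (fun k _ => residualPoly_succ H k), residualPoly_zero, ← C_mul', mul_one, mul_sum]
    rw [sub_eq_add_neg, ← sum_neg_distrib]
    congr 1
    refine sum_congr rfl fun j _ => ?_
    rw [mul_smul_comm, ← smul_neg]
    congr 1
    ring
  have hY0 : Y 0 = residualPoly H n := by
    simp only [hY, certWeight, ite_smul, one_smul, zero_smul]
    rw [sum_ite_eq' (range (n + 1)) n, if_pos (by simp)]
  have hYn : Y (n + 1) = 0 :=
    sum_eq_zero fun k _ => by rw [certWeight_eq_zero _ _ (by omega), zero_smul]
  have hm : ∀ m, Y 0 = ∑ l ∈ range m, C (Pinv H n l) * (X - 1) ^ l + (X - 1) ^ m * Y m := by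
    intro m
    induction m with
    | zero => simp
    | succ m ih =>
      rw [ih, hstep m, sum_range_succ]
      ring
  rw [← hY0, hm (n + 1), hYn, mul_zero, add_zero]

theorem Pinv_eq_of_residualPoly_eq {H : ℕ → ℕ → ℝ} {n : ℕ}
    (h : ∀ i ≤ n, (residualPoly H n).coeff i = 1 / ((n + 1 : ℕ) : ℝ)) {l : ℕ} (hl : l ≤ n) :
    Pinv H n l = 1 / ((n + 1 : ℕ) : ℝ) * ((n + 1).choose (l + 1) : ℝ) := by
  have h1 : (residualPoly H n).comp (X + 1) = ∑ l ∈ range (n + 1), C (Pinv H n l) * X ^ l := by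
    rw [residualPoly_eq_sum_Pinv, Polynomial.sum_comp]
    simp
  have h2 : residualPoly H n = ∑ i ∈ range (n + 1), C (1 / ((n + 1 : ℕ) : ℝ)) * X ^ i := by
    ext i
    simp only [finsetSum_coeff, coeff_C_mul_X_pow]
    rw [sum_ite_eq (range (n + 1)) i]
    split_ifs with hi
    · exact h i (by rw [mem_range] at hi; omega)
    · exact coeff_residualPoly_eq_zero H (by rw [mem_range] at hi; omega)
  have h3 : ∀ m, ∑ i ∈ range m, (i.choose l : ℝ) = (m.choose (l + 1) : ℝ) := by
    intro m
    induction m with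
    | zero => simp
    | succ m ih => rw [sum_range_succ, ih, Nat.choose_succ_succ]; push_cast; ring
  have h4 := congrArg (fun f => f.coeff l) h1
  simp only [finsetSum_coeff, coeff_C_mul_X_pow] at h4
  rw [sum_ite_eq (range (n + 1)) l, if_pos (by rw [mem_range]; omega), h2, Polynomial.sum_comp,
    finsetSum_coeff] at h4
  rw [← h4, ← h3, mul_sum]
  refine sum_congr rfl fun i _ => ?_
  rw [mul_comp, C_comp, X_pow_comp, coeff_C_mul, coeff_X_add_one_pow]

end Polynomials

section Gram

theorem exists_inner_eq {ι : Type*} [Fintype ι] (G : ι → ι → ℝ) (hG : ∀ i j, G i j = G j i)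
    (hpos : ∀ c : ι → ℝ, 0 ≤ ∑ i, ∑ j, c i * c j * G i j) :
    ∃ b : ι → EuclideanSpace ℝ (Fin (Fintype.card ι)), ∀ i j, inner ℝ (b i) (b j) = G i j := by
  classical
  open scoped MatrixOrder in
  have hM : (Matrix.of G).PosSemidef := by
    refine Matrix.PosSemidef.of_dotProduct_mulVec_nonneg ?_ fun c => ?_
    · ext i j
      simp [hG i j]
    · refine (hpos c).trans_eq ?_
      simp only [dotProduct, Matrix.mulVec, star_trivial, mul_sum, Matrix.of_apply]
      exact sum_congr rfl fun i _ => sum_congr rfl fun j _ => by ring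
  obtain ⟨B, hB⟩ := CStarAlgebra.nonneg_iff_eq_star_mul_self.mp hM.nonneg
  refine ⟨fun i => WithLp.toLp 2 fun k => B ((Fintype.equivFin ι).symm k) i, fun i j => ?_⟩
  have h := congrFun (congrFun hB i) j
  rw [Matrix.of_apply, Matrix.star_eq_conjTranspose, Matrix.mul_apply] at h
  rw [h, PiLp.inner_apply, ← (Fintype.equivFin ι).symm.sum_comp]
  refine sum_congr rfl fun k _ => ?_
  simp [mul_comm]

theorem abs_sum_sum_mul_le {ι : Type*} [Fintype ι] (D : ι → ι → ℝ) (c : ι → ℝ) :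
    |∑ i, ∑ j, c i * c j * D i j| ≤ (∑ i, c i ^ 2) * ∑ i, ∑ j, |D i j| := by
  have hle : ∀ i, c i ^ 2 ≤ ∑ i, c i ^ 2 := fun i =>
    single_le_sum (f := fun i => c i ^ 2) (fun _ _ => sq_nonneg _) (mem_univ i)
  rw [mul_sum]
  refine (abs_sum_le_sum_abs _ _).trans (sum_le_sum fun i _ => ?_)
  rw [mul_sum]
  refine (abs_sum_le_sum_abs _ _).trans (sum_le_sum fun j _ => ?_)
  rw [abs_mul]
  refine mul_le_mul_of_nonneg_right (abs_le.2 ⟨?_, ?_⟩) (abs_nonneg _)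
  · nlinarith [hle i, hle j, sq_nonneg (c i + c j)]
  · nlinarith [hle i, hle j, sq_nonneg (c i - c j)]

theorem exists_gram_perturbation {m : ℕ} (D : Fin m → Fin m → ℝ) (hD : ∀ i j, D i j = D j i)
    (w : Fin m → ℝ) :
    ∃ K ε₀ : ℝ, 0 < ε₀ ∧ ∀ ε, 0 < ε → ε ≤ ε₀ → ∃ d, 1 ≤ d ∧
      ∃ (b : Fin m → EuclideanSpace ℝ (Fin d)) (v : EuclideanSpace ℝ (Fin d)),
        (∀ i j, inner ℝ (b i) (b j) = (if i = j then 1 else 0) + ε * D i j) ∧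
        (∀ i, inner ℝ v (b i) = ε * w i) ∧ ‖v‖ ^ 2 = K * ε ^ 2 := by
  set S := ∑ i, ∑ j, |D i j| with hS
  have hS0 : 0 ≤ S := sum_nonneg fun i _ => sum_nonneg fun j _ => abs_nonneg _
  refine ⟨2 * ∑ i, w i ^ 2, 1 / (2 * (S + 1)), by positivity, fun ε hε hε₀ => ?_⟩
  have hεS : ε * S ≤ 1 / 2 := by
    rw [le_div_iff₀ (by positivity)] at hε₀
    linarith
  obtain ⟨b, hb⟩ := exists_inner_eq
    (fun i j : Option (Fin m) => i.elim (j.elim (2 * (∑ i, w i ^ 2) * ε ^ 2) fun j => ε * w j)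
      fun i => j.elim (ε * w i) fun j => (if i = j then 1 else 0) + ε * D i j)
    (by
      rintro (_ | i) (_ | j)
      · rfl
      · rfl
      · rfl
      · simp only [Option.elim, hD i j, eq_comm])
    (fun c => by
      set s := c none
      set e : Fin m → ℝ := fun i => c (some i) with he
      have hab := neg_le_of_abs_le (abs_sum_sum_mul_le D e)
      have hsq : 0 ≤ ∑ i, (e i + 2 * ε * s * w i) ^ 2 := sum_nonneg fun _ _ => sq_nonneg _
      have hsq2 : ∑ i, (e i + 2 * ε * s * w i) ^ 2 = ∑ i, e i ^ 2
          + 4 * (ε * s) * ∑ i, w i * e i + 4 * (ε * s) ^ 2 * ∑ i, w i ^ 2 := by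
        simp only [mul_sum, ← sum_add_distrib]
        exact sum_congr rfl fun _ _ => by ring
      have hexp : ∑ i, ∑ j, c i * c j * (i.elim
          (j.elim (2 * (∑ i, w i ^ 2) * ε ^ 2) fun j => ε * w j)
            fun i => j.elim (ε * w i) fun j => (if i = j then 1 else 0) + ε * D i j) =
          2 * (ε * s) ^ 2 * (∑ i, w i ^ 2) + 2 * (ε * s) * (∑ i, w i * e i)
            + ∑ i, e i ^ 2 + ε * ∑ i, ∑ j, e i * e j * D i j := by
        simp only [Fintype.sum_option, Option.elim, sum_add_distrib, mul_add, mul_ite, mul_one,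
          mul_zero, sum_ite_eq, mem_univ, if_true]
        have e1 : ∑ j, c none * c (some j) * (ε * w j) = (ε * s) * ∑ i, w i * e i := by
          rw [mul_sum]
          exact sum_congr rfl fun _ _ => by ring
        have e2 : ∑ j, c (some j) * c none * (ε * w j) = (ε * s) * ∑ i, w i * e i := by
          rw [mul_sum]
          exact sum_congr rfl fun _ _ => by ring
        have e3 : ∑ i, ∑ j, c (some i) * c (some j) * (ε * D i j) =
            ε * ∑ i, ∑ j, e i * e j * D i j := by
          simp only [mul_sum]
          exact sum_congr rfl fun _ _ => sum_congr rfl fun _ _ => by ring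
        have e4 : ∑ i, c (some i) * c (some i) = ∑ i, e i ^ 2 :=
          sum_congr rfl fun _ _ => by ring
        rw [e1, e2, e3, e4]
        ring
      rw [hexp]
      have h1 : 0 ≤ ∑ i, e i ^ 2 := sum_nonneg fun _ _ => sq_nonneg _
      have h2 := mul_le_mul_of_nonneg_left hab hε.le
      have h3 := mul_le_mul_of_nonneg_left hεS h1
      rw [hsq2] at hsq
      linarith)
  refine ⟨_, Fintype.card_pos, fun i => b (some i), b none, fun i j => hb _ _, fun i => hb _ _, ?_⟩
  rw [← real_inner_self_eq_norm_sq, hb]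
  rfl

end Gram

section Forms

open Polynomial

/-- The symmetric bilinear form `(f, g) ↦ ∑_{i ≤ n} f_i g_i` on polynomials. -/
noncomputable def coeffForm (n : ℕ) : LinearMap.BilinForm ℝ ℝ[X] :=
  ∑ i ∈ range (n + 1), LinearMap.BilinForm.linMulLin (lcoeff ℝ i) (lcoeff ℝ i)

theorem coeffForm_apply (n : ℕ) (f g : ℝ[X]) :
    coeffForm n f g = ∑ i ∈ range (n + 1), f.coeff i * g.coeff i := by
  simp [coeffForm, LinearMap.sum_apply]

theorem coeffForm_X_mul {n : ℕ} {f : ℝ[X]} (hf : f ∈ degreeLT ℝ n) :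
    coeffForm n (X * f) (X * f) = coeffForm n f f := by
  rw [mem_degreeLT, degree_lt_iff_coeff_zero] at hf
  rw [coeffForm_apply, coeffForm_apply, sum_range_succ', sum_range_succ, hf n le_rfl]
  simp [coeff_X_mul]

theorem eval_one_residualPoly (H : ℕ → ℕ → ℝ) (k : ℕ) : (residualPoly H k).eval 1 = 1 := by
  simp [residualPoly_eq]

theorem sum_coeff_residualPoly (H : ℕ → ℕ → ℝ) {n k : ℕ} (hk : k ≤ n) :
    ∑ i ∈ range (n + 1), (residualPoly H k).coeff i = 1 := by
  have h : (residualPoly H k).natDegree < n + 1 := Nat.lt_succ_of_le <|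
    natDegree_le_iff_coeff_eq_zero.2 fun m hm => coeff_residualPoly_eq_zero H (by omega)
  rw [← eval_one_residualPoly H k, eval_eq_sum_range' h]
  simp

theorem coeffForm_residualPoly (H : ℕ → ℕ → ℝ) {n k : ℕ} (hk : k ≤ n) {σ : ℝ[X]}
    (hσ : ∀ i ≤ n, σ.coeff i = 1) :
    coeffForm n (σ - ((2 : ℝ) • displacementPoly H k + residualPoly H k)) (residualPoly H k) =
      0 := by
  set r := displacementPoly H k with hr
  have hr0 : r ∈ degreeLT ℝ n := degreeLT_mono hk (displacementPoly_mem_degreeLT H k)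
  have h1 : coeffForm n σ (residualPoly H k) = 1 := by
    rw [coeffForm_apply, ← sum_coeff_residualPoly H hk]
    exact sum_congr rfl fun i hi => by rw [hσ i (by rw [mem_range] at hi; omega), one_mul]
  have h2 : residualPoly H k = 1 - r + X * r := by
    rw [residualPoly_eq]
    ring
  have h3 : (2 : ℝ) • r + residualPoly H k = 1 + r + X * r := by
    rw [h2, two_smul]
    ring
  have h4 := coeffForm_X_mul hr0
  have hone : ∀ f : ℝ[X], coeffForm n 1 f = f.coeff 0 := fun f => by
    rw [coeffForm_apply, sum_range_succ', sum_eq_zero] <;> simp [coeff_one]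
  have hsymm : ∀ f g, coeffForm n f g = coeffForm n g f := fun f g => by
    simp only [coeffForm_apply, mul_comm]
  rw [map_sub, LinearMap.sub_apply, h1, h3, h2]
  simp only [map_add, map_sub, LinearMap.add_apply, hone, hsymm _ 1, h4, hsymm (X * r) r]
  simp only [coeff_one_zero, mul_coeff_zero, coeff_X_zero, zero_mul]
  ring

/-- Every symmetric bilinear form is, on polynomials of degree less than `n`, the defect of a
symmetric bilinear form under multiplication by `X`. -/
theorem exists_form_sub_form_X_mul (E : LinearMap.BilinForm ℝ ℝ[X]) (hE : ∀ f g, E f g = E g f)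
    (n : ℕ) : ∃ D : LinearMap.BilinForm ℝ ℝ[X], (∀ f g, D f g = D g f) ∧
      ∀ f ∈ degreeLT ℝ n, D f f - D (X * f) (X * f) = E f f := by
  let L : ℝ[X] →ₗ[ℝ] ℝ[X] :=
    { toFun := divX
      map_add' := fun _ _ => divX_add
      map_smul' := fun c f => by ext i; simp [coeff_divX] }
  have hLX : ∀ f, L (X * f) = f := fun f => by
    ext i
    simp [L, coeff_divX, coeff_X_mul]
  have hcoeff : ∀ (r : ℕ) (f : ℝ[X]) i, ((L ^ r) f).coeff i = f.coeff (i + r) := by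
    intro r
    induction r with
    | zero => simp
    | succ r ih =>
      intro f i
      rw [pow_succ, Module.End.mul_apply, ih]
      simp [L, coeff_divX, add_assoc]
  refine ⟨-∑ r ∈ range n, E.comp (L ^ (r + 1)) (L ^ (r + 1)), fun f g => ?_, fun f hf => ?_⟩
  · simp only [LinearMap.neg_apply, LinearMap.sum_apply, LinearMap.BilinForm.comp_apply]
    exact congrArg _ (sum_congr rfl fun r _ => hE _ _)
  · have hn : (L ^ n) f = 0 := by
      rw [mem_degreeLT, degree_lt_iff_coeff_zero] at hf
      ext i
      rw [hcoeff, hf _ (by omega), coeff_zero]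
    simp only [LinearMap.neg_apply, LinearMap.sum_apply, LinearMap.BilinForm.comp_apply]
    have h1 : ∀ r, (L ^ (r + 1)) (X * f) = (L ^ r) f := fun r => by
      rw [pow_succ, Module.End.mul_apply, hLX]
    simp only [h1]
    have h := (sum_range_succ (fun r => E ((L ^ r) f) ((L ^ r) f)) n).symm.trans
      (sum_range_succ' _ _)
    simp only [hn, map_zero, add_zero, pow_zero, Module.End.one_apply] at h
    linarith

theorem exists_linearMap_inner_eq {V : Type*} [NormedAddCommGroup V] [InnerProductSpace ℝ V]
    {n : ℕ} (B : LinearMap.BilinForm ℝ ℝ[X]) (w : ℝ[X] →ₗ[ℝ] ℝ) (b : Fin (n + 1) → V) (v : V)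
    (hb : ∀ i j, inner ℝ (b i) (b j) = B (X ^ (i : ℕ)) (X ^ (j : ℕ)))
    (hv : ∀ i, inner ℝ v (b i) = w (X ^ (i : ℕ))) :
    ∃ Ψ : ℝ[X] →ₗ[ℝ] V,
      (∀ f ∈ degreeLT ℝ (n + 1), ∀ g ∈ degreeLT ℝ (n + 1), inner ℝ (Ψ f) (Ψ g) = B f g) ∧
      ∀ f ∈ degreeLT ℝ (n + 1), inner ℝ v (Ψ f) = w f := by
  have hexp : ∀ f ∈ degreeLT ℝ (n + 1), f = ∑ i : Fin (n + 1), f.coeff i • X ^ (i : ℕ) := by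
    intro f hf
    rw [mem_degreeLT, degree_lt_iff_coeff_zero] at hf
    rw [Finset.sum_range (fun i => f.coeff i • X ^ i) |>.symm]
    ext i
    simp only [finsetSum_coeff, coeff_smul, coeff_X_pow, smul_eq_mul, mul_ite, mul_one, mul_zero]
    rw [sum_ite_eq (range (n + 1)) i]
    split_ifs with hi
    · rfl
    · exact hf i (by rw [mem_range] at hi; omega)
  refine ⟨∑ i : Fin (n + 1), (lcoeff ℝ (i : ℕ)).smulRight (b i), fun f hf g hg => ?_,
    fun f hf => ?_⟩
  · conv_rhs => rw [hexp f hf, hexp g hg]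
    simp [LinearMap.sum_apply, sum_inner, inner_sum, real_inner_smul_left, real_inner_smul_right,
      hb, mul_sum]
  · conv_rhs => rw [hexp f hf]
    simp [LinearMap.sum_apply, inner_sum, real_inner_smul_right, hv]

end Forms

section Necessity

open Polynomial

theorem inner_sub_residualPoly {V : Type*} [NormedAddCommGroup V] [InnerProductSpace ℝ V]
    (H : ℕ → ℕ → ℝ) (Ψ : ℝ[X] →ₗ[ℝ] V) (y0 : V) (k j : ℕ) :
    inner ℝ ((y0 - (2 : ℝ) • Ψ (displacementPoly H k) - Ψ (residualPoly H k)) -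
      (y0 - (2 : ℝ) • Ψ (displacementPoly H j) - Ψ (residualPoly H j)))
      (Ψ (residualPoly H k) - Ψ (residualPoly H j)) =
    ‖Ψ (displacementPoly H k - displacementPoly H j)‖ ^ 2 -
      ‖Ψ (X * (displacementPoly H k - displacementPoly H j))‖ ^ 2 := by
  set ρ := displacementPoly H k - displacementPoly H j with hρ
  have hp : residualPoly H k - residualPoly H j = X * ρ - ρ := by
    rw [residualPoly_eq, residualPoly_eq, hρ]
    ring
  have hu : Ψ (residualPoly H k) - Ψ (residualPoly H j) = Ψ (X * ρ) - Ψ ρ := by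
    rw [← map_sub, hp, map_sub]
  have hx : (y0 - (2 : ℝ) • Ψ (displacementPoly H k) - Ψ (residualPoly H k)) -
      (y0 - (2 : ℝ) • Ψ (displacementPoly H j) - Ψ (residualPoly H j)) =
      -(Ψ (X * ρ) + Ψ ρ) := by
    have h1 : Ψ (displacementPoly H k) - Ψ (displacementPoly H j) = Ψ ρ := by rw [hρ, map_sub]
    calc _ = -((2 : ℝ) • (Ψ (displacementPoly H k) - Ψ (displacementPoly H j))
          + (Ψ (residualPoly H k) - Ψ (residualPoly H j))) := by module
      _ = _ := by rw [h1, hu]; module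
  rw [hx, hu, inner_neg_left, inner_sub_right, inner_add_left, inner_add_left,
    real_inner_self_eq_norm_sq, real_inner_self_eq_norm_sq, real_inner_comm (Ψ ρ)]
  ring

theorem sub_displacementPoly_succ {V : Type*} [NormedAddCommGroup V] [InnerProductSpace ℝ V]
    (H : ℕ → ℕ → ℝ) (Ψ : ℝ[X] →ₗ[ℝ] V) (y0 : V) (k : ℕ) :
    y0 - (2 : ℝ) • Ψ (displacementPoly H (k + 1)) = y0 - (2 : ℝ) • Ψ (displacementPoly H k) -
      ∑ j ∈ range (k + 1), H (k + 1) (j + 1) • (2 : ℝ) • Ψ (residualPoly H j) := by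
  rw [displacementPoly, sum_range_succ, ← displacementPoly, map_add, smul_add, sub_add_eq_sub_sub,
    map_sum, smul_sum]
  simp only [map_smul, smul_comm (2 : ℝ)]

theorem IsExactOptimal.norm_sq_le_of_linearMap {H : ℕ → ℕ → ℝ} {n d : ℕ} (h : IsExactOptimal H n)
    (hd : 1 ≤ d) (Ψ : ℝ[X] →ₗ[ℝ] EuclideanSpace ℝ (Fin d)) (y0 : EuclideanSpace ℝ (Fin d))
    (hpair : ∀ k ≤ n, ∀ j ≤ n, 0 ≤ ‖Ψ (displacementPoly H k - displacementPoly H j)‖ ^ 2 -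
      ‖Ψ (X * (displacementPoly H k - displacementPoly H j))‖ ^ 2)
    (hstar : ∀ k ≤ n, 0 ≤ inner ℝ
      (y0 - Ψ ((2 : ℝ) • displacementPoly H k + residualPoly H k)) (Ψ (residualPoly H k))) :
    (((n + 1 : ℕ) : ℝ) * ‖Ψ (residualPoly H n)‖) ^ 2 ≤ ‖y0‖ ^ 2 := by
  have := h.norm_sq_le hd (fun k => y0 - (2 : ℝ) • Ψ (displacementPoly H k))
    (fun k => Ψ (residualPoly H k)) (fun k _ => sub_displacementPoly_succ H Ψ y0 k)
    (fun k hk j hj => ?_) (fun k hk => ?_)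
  · simpa [displacementPoly] using this
  · rw [inner_sub_residualPoly]
    exact hpair k hk j hj
  · have := hstar k hk
    rwa [map_add, map_smul, ← sub_sub] at this

theorem displacementPoly_sub_mem_degreeLT (H : ℕ → ℕ → ℝ) {n k j : ℕ} (hk : k ≤ n) (hj : j ≤ n) :
    displacementPoly H k - displacementPoly H j ∈ degreeLT ℝ n :=
  Submodule.sub_mem _ (degreeLT_mono hk (displacementPoly_mem_degreeLT H k))
    (degreeLT_mono hj (displacementPoly_mem_degreeLT H j))

theorem X_mul_mem_degreeLT {n : ℕ} {f : ℝ[X]} (hf : f ∈ degreeLT ℝ n) :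
    X * f ∈ degreeLT ℝ (n + 1) := by
  rw [mem_degreeLT, degree_lt_iff_coeff_zero] at hf ⊢
  intro m hm
  obtain ⟨m, rfl⟩ : ∃ i, m = i + 1 := ⟨m - 1, by omega⟩
  rw [coeff_X_mul]
  exact hf m (by omega)

theorem two_smul_add_residualPoly_mem_degreeLT (H : ℕ → ℕ → ℝ) {n k : ℕ} (hk : k ≤ n) :
    (2 : ℝ) • displacementPoly H k + residualPoly H k ∈ degreeLT ℝ (n + 1) :=
  Submodule.add_mem _
    (Submodule.smul_mem _ _ (degreeLT_mono (by omega) (displacementPoly_mem_degreeLT H k)))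
    (degreeLT_mono (by omega) (residualPoly_mem_degreeLT H k))

theorem coeffForm_X_pow (n : ℕ) (i j : Fin (n + 1)) :
    coeffForm n (X ^ (i : ℕ)) (X ^ (j : ℕ)) = if i = j then 1 else 0 := by
  rw [coeffForm_apply, sum_eq_single_of_mem (i : ℕ) (by simp [i.2])
    (fun m _ hm => by simp [coeff_X_pow, hm])]
  simp [coeff_X_pow, Fin.ext_iff]

theorem IsExactOptimal.coeff_residualPoly {H : ℕ → ℕ → ℝ} {n : ℕ} (h : IsExactOptimal H n) :
    ∀ i ≤ n, (residualPoly H n).coeff i = 1 / ((n + 1 : ℕ) : ℝ) := by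
  obtain ⟨Ψ, hΨ, -⟩ := exists_linearMap_inner_eq (coeffForm n) 0
    (fun i => EuclideanSpace.single i (1 : ℝ)) 0
    (fun i j => by rw [coeffForm_X_pow]; simp [EuclideanSpace.inner_single_left])
    (fun i => by simp)
  have hnorm : ∀ f ∈ degreeLT ℝ (n + 1), ‖Ψ f‖ ^ 2 = coeffForm n f f := fun f hf => by
    rw [← real_inner_self_eq_norm_sq, hΨ f hf f hf]
  set σ : ℝ[X] := ∑ i ∈ range (n + 1), X ^ i with hσ
  have hσc : ∀ i ≤ n, σ.coeff i = 1 := fun i hi => by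
    simp only [hσ, finsetSum_coeff, coeff_X_pow]
    rw [sum_ite_eq (range (n + 1)) i, if_pos (by rw [mem_range]; omega)]
  have hσd : σ ∈ degreeLT ℝ (n + 1) := Submodule.sum_mem _ fun i hi => by
    rw [mem_range] at hi
    rw [mem_degreeLT]
    exact (degree_X_pow_le i).trans_lt (by exact_mod_cast hi)
  have key := h.norm_sq_le_of_linearMap (Nat.le_add_left 1 n) Ψ (Ψ σ) (fun k hk j hj => by
      have hρ := displacementPoly_sub_mem_degreeLT H hk hj
      rw [hnorm _ (degreeLT_mono (Nat.le_succ n) hρ), hnorm _ (X_mul_mem_degreeLT hρ),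
        coeffForm_X_mul hρ, sub_self])
    (fun k hk => by
      rw [← map_sub, hΨ _ (Submodule.sub_mem _ hσd (two_smul_add_residualPoly_mem_degreeLT H hk)) _
        (degreeLT_mono (by omega) (residualPoly_mem_degreeLT H k)), coeffForm_residualPoly H hk hσc])
  rw [mul_pow, hnorm _ hσd, hnorm _ (residualPoly_mem_degreeLT H n), coeffForm_apply,
    coeffForm_apply] at key
  have hσσ : ∑ i ∈ range (n + 1), σ.coeff i * σ.coeff i = ((n + 1 : ℕ) : ℝ) := by
    rw [sum_congr rfl fun i hi => by rw [hσc i (by rw [mem_range] at hi; omega), mul_one]]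
    simp
  have hsum := sum_coeff_residualPoly H (le_refl n)
  set N : ℝ := ((n + 1 : ℕ) : ℝ) with hN
  have hN0 : N ≠ 0 := by rw [hN]; positivity
  have hsq : ∑ i ∈ range (n + 1), (N * (residualPoly H n).coeff i - 1) ^ 2 =
      N ^ 2 * ∑ i ∈ range (n + 1), (residualPoly H n).coeff i * (residualPoly H n).coeff i
        - 2 * N * ∑ i ∈ range (n + 1), (residualPoly H n).coeff i + N := by
    have hcard : ∑ i ∈ range (n + 1), (1 : ℝ) = N := by simp [hN]
    nth_rewrite 4 [← hcard]
    simp only [mul_sum, ← sum_sub_distrib, ← sum_add_distrib]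
    exact sum_congr rfl fun _ _ => by ring
  have h0 : ∑ i ∈ range (n + 1), (N * (residualPoly H n).coeff i - 1) ^ 2 = 0 := by
    refine le_antisymm ?_ (sum_nonneg fun _ _ => sq_nonneg _)
    rw [hsq, hsum]
    linarith
  intro i hi
  have h1 := (sum_eq_zero_iff_of_nonneg fun _ _ => sq_nonneg _).1 h0 i (by rw [mem_range]; omega)
  rw [eq_div_iff hN0]
  have := pow_eq_zero_iff (two_ne_zero) |>.1 h1
  linarith

theorem IsExactOptimal.lamStar_nonneg {H : ℕ → ℕ → ℝ} {n : ℕ} (h : IsExactOptimal H n) {a b : ℕ}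
    (hba : b < a) (ha : a ≤ n) : 0 ≤ lamStar (n + 1) H (a + 1) (b + 1) := by
  have hcoeff := h.coeff_residualPoly
  have hP := fun l (hl : l ≤ n) => Pinv_eq_of_residualPoly_eq hcoeff hl
  set N : ℝ := ((n + 1 : ℕ) : ℝ) with hN
  have hN0 : 0 < N := by rw [hN]; positivity
  have hlead : (residualPoly H n).coeff n ≠ 0 := by
    rw [hcoeff n le_rfl]
    positivity
  set σ : ℝ[X] := N • residualPoly H n with hσ
  have hσc : ∀ i ≤ n, σ.coeff i = 1 := fun i hi => by
    rw [hσ, coeff_smul, hcoeff i hi, smul_eq_mul, mul_one_div_cancel hN0.ne']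
  have hσd : σ ∈ degreeLT ℝ (n + 1) := Submodule.smul_mem _ _ (residualPoly_mem_degreeLT H n)
  obtain ⟨φ, hφ⟩ := exists_functional_residualPoly hlead fun k => if k = a then 1 else 0
  obtain ⟨ψ, hψ⟩ := exists_functional_residualPoly hlead fun k => if k = b then 1 else 0
  set F : LinearMap.BilinForm ℝ ℝ[X] := LinearMap.BilinForm.linMulLin
    (φ ∘ₗ LinearMap.mulLeft ℝ (1 - X)) (ψ ∘ₗ LinearMap.mulLeft ℝ (1 - X)) with hF
  obtain ⟨D, hDs, hD⟩ := exists_form_sub_form_X_mul (-(1 / 2 : ℝ) • (F + LinearMap.flip F))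
    (fun f g => by
      simp only [LinearMap.smul_apply, LinearMap.add_apply, LinearMap.flip_apply, add_comm]) n
  have hE : ∀ f, (-(1 / 2 : ℝ) • (F + LinearMap.flip F)) f f =
      -(φ ((1 - X) * f) * ψ ((1 - X) * f)) := fun f => by
    rw [LinearMap.smul_apply, LinearMap.smul_apply, LinearMap.add_apply, LinearMap.add_apply,
      LinearMap.flip_apply, hF, LinearMap.BilinForm.linMulLin_apply, smul_eq_mul,
      LinearMap.comp_apply, LinearMap.comp_apply, LinearMap.mulLeft_apply]
    ring
  have hDρ : ∀ k ≤ n, ∀ j ≤ n, D (displacementPoly H k - displacementPoly H j)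
      (displacementPoly H k - displacementPoly H j) -
      D (X * (displacementPoly H k - displacementPoly H j))
        (X * (displacementPoly H k - displacementPoly H j)) =
      if (k = a ∧ j = b) ∨ (k = b ∧ j = a) then 1 else 0 := by
    intro k hk j hj
    have hL : (1 - X) * (displacementPoly H k - displacementPoly H j) =
        residualPoly H j - residualPoly H k := by
      rw [residualPoly_eq, residualPoly_eq]
      ring
    rw [hD _ (displacementPoly_sub_mem_degreeLT H hk hj), hE, hL]
    simp only [map_sub, hφ k hk, hφ j hj, hψ k hk, hψ j hj]
    split_ifs <;> first | omega | norm_num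
  obtain ⟨w, hw⟩ := exists_functional_residualPoly hlead fun k =>
    -D (σ - ((2 : ℝ) • displacementPoly H k + residualPoly H k)) (residualPoly H k)
  obtain ⟨K, ε₀, hε₀, hgram⟩ := exists_gram_perturbation
    (fun i j : Fin (n + 1) => D (X ^ (i : ℕ)) (X ^ (j : ℕ))) (fun i j => hDs _ _)
    (fun i => w (X ^ (i : ℕ)))
  set lam := lamStar (n + 1) H (a + 1) (b + 1) with hlam
  have key : ∀ ε, 0 < ε → ε ≤ ε₀ → 0 ≤ 2 * N * lam + K * ε := by
    intro ε hε hle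
    obtain ⟨d, hd, c, v, hc, hv, hvn⟩ := hgram ε hε hle
    obtain ⟨Ψ, hΨ, hΨv⟩ := exists_linearMap_inner_eq (coeffForm n + ε • D) (ε • w) c v
      (fun i j => by
        rw [hc, LinearMap.add_apply, LinearMap.add_apply, coeffForm_X_pow]
        rfl)
      (fun i => hv i)
    have hp : ∀ k ≤ n, residualPoly H k ∈ degreeLT ℝ (n + 1) := fun k hk =>
      degreeLT_mono (by omega) (residualPoly_mem_degreeLT H k)
    have hnorm : ∀ f ∈ degreeLT ℝ (n + 1), ‖Ψ f‖ ^ 2 = coeffForm n f f + ε * D f f :=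
      fun f hf => by
        rw [← real_inner_self_eq_norm_sq, hΨ f hf f hf]
        rfl
    have hpair : ∀ k ≤ n, ∀ j ≤ n, ‖Ψ (displacementPoly H k - displacementPoly H j)‖ ^ 2 -
        ‖Ψ (X * (displacementPoly H k - displacementPoly H j))‖ ^ 2 =
        if (k = a ∧ j = b) ∨ (k = b ∧ j = a) then ε else 0 := by
      intro k hk j hj
      have hρ := displacementPoly_sub_mem_degreeLT H hk hj
      rw [hnorm _ (degreeLT_mono (Nat.le_succ n) hρ), hnorm _ (X_mul_mem_degreeLT hρ),
        coeffForm_X_mul hρ]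
      have := hDρ k hk j hj
      split_ifs at this ⊢ <;> linear_combination ε * this
    have hstar : ∀ k ≤ n, inner ℝ
        (Ψ σ + v - Ψ ((2 : ℝ) • displacementPoly H k + residualPoly H k))
        (Ψ (residualPoly H k)) = 0 := by
      intro k hk
      rw [add_sub_right_comm, ← map_sub, inner_add_left, hΨv _ (hp k hk), hΨ _ (Submodule.sub_mem _
        hσd (two_smul_add_residualPoly_mem_degreeLT H hk)) _ (hp k hk), LinearMap.add_apply,
        LinearMap.add_apply, coeffForm_residualPoly H hk hσc, LinearMap.smul_apply,
        LinearMap.smul_apply, LinearMap.smul_apply, hw k hk, smul_eq_mul, smul_eq_mul]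
      ring
    have hbound := h.norm_sq_le_of_linearMap hd Ψ (Ψ σ + v)
      (fun k hk j hj => by rw [hpair k hk j hj]; split_ifs <;> simp [hε.le])
      (fun k hk => (hstar k hk).ge)
    have hid := sum_lamStar_mul_inner H n hP (fun k => Ψ σ + v - (2 : ℝ) • Ψ (displacementPoly H k))
      (fun k => Ψ (residualPoly H k)) (fun k _ => sub_displacementPoly_succ H Ψ _ k)
    have hlhs : ∑ k ∈ range (n + 1), ∑ j ∈ range k, lamStar (n + 1) H (k + 1) (j + 1) *
        inner ℝ ((Ψ σ + v - (2 : ℝ) • Ψ (displacementPoly H k) - Ψ (residualPoly H k)) -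
          (Ψ σ + v - (2 : ℝ) • Ψ (displacementPoly H j) - Ψ (residualPoly H j)))
          (Ψ (residualPoly H k) - Ψ (residualPoly H j)) = lam * ε := by
      rw [sum_eq_single_of_mem a (by rw [mem_range]; omega) fun k hk hka => sum_eq_zero fun j hj => ?_,
        sum_eq_single_of_mem b (by rw [mem_range]; omega) fun j hj hjb => ?_]
      · rw [inner_sub_residualPoly, hpair a ha b (by omega), if_pos (by simp)]
      · rw [mem_range] at hj
        rw [inner_sub_residualPoly, hpair a ha j (by omega), if_neg (by omega), mul_zero]
      · rw [mem_range] at hk hj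
        beta_reduce
        rw [inner_sub_residualPoly, hpair k (by omega) j (by omega), if_neg (by omega), mul_zero]
    rw [hlhs] at hid
    have hs : inner ℝ (Ψ σ + v - (2 : ℝ) • Ψ (displacementPoly H n) - Ψ (residualPoly H n))
        (Ψ (residualPoly H n)) = 0 := by
      rw [sub_sub, ← map_smul, ← map_add]
      exact hstar n le_rfl
    have hr0 : displacementPoly H 0 = 0 := sum_range_zero _
    have hσu : Ψ σ = N • Ψ (residualPoly H n) := by rw [hσ, map_smul]
    simp only [hr0, map_zero, smul_zero, sub_zero] at hid
    rw [← hN, inner_sub_right, inner_sub_right, real_inner_comm _ (Ψ (residualPoly H n)),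
      real_inner_comm _ (Ψ (residualPoly H n)), hs, hσu, inner_add_left, real_inner_smul_left,
      real_inner_smul_right] at hid
    rw [← hN, hσu, norm_add_sq_real, norm_smul, Real.norm_of_nonneg hN0.le, real_inner_smul_left, hvn,
      real_inner_comm v] at hbound
    have : 0 ≤ ε * (2 * N * lam + K * ε) := by
      have e : inner ℝ v (Ψ (residualPoly H n)) = lam * ε := by linarith
      rw [e] at hbound
      linarith
    exact nonneg_of_mul_nonneg_right this hε
  by_contra! hneg
  have hpos : 0 < -(N * lam) / (|K| + 1) := by
    have := mul_neg_of_pos_of_neg hN0 hneg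
    exact div_pos (by linarith) (by positivity)
  have h1 := key _ (lt_min hε₀ hpos) (min_le_left _ _)
  set ε := min ε₀ (-(N * lam) / (|K| + 1)) with hε
  have hεpos : 0 < ε := lt_min hε₀ hpos
  have h2 : ε * (|K| + 1) ≤ -(N * lam) := by
    rw [← le_div_iff₀ (by positivity)]
    exact min_le_right _ _
  have h3 : K * ε ≤ |K| * ε := mul_le_mul_of_nonneg_right (le_abs_self K) hεpos.le
  have h4 := mul_neg_of_pos_of_neg hN0 hneg
  linarith

end Necessity

/-- **Complete characterization of exact optimality (Theorem 2.3 / main result).**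
An H-matrix algorithm achieves the exact optimal worst-case rate
`‖y_{N−1} − T y_{N−1}‖² ≤ 4‖y₀ − y⋆‖²/N²` over all nonexpansive operators if and only if
the H-invariance conditions `P(N−1,m;H) = (1/N)·C(N,m+1)` hold for `m = 1,…,N−1` and the
H-certificates `λ*_{k,j}(H)` are nonnegative for all `1 ≤ j < k ≤ N`. -/
theorem hmatrix_optimality_characterization (N : ℕ) (hN : 2 ≤ N) (H : ℕ → ℕ → ℝ) :
    (∀ (d : ℕ), 1 ≤ d →
      ∀ (T : EuclideanSpace ℝ (Fin d) → EuclideanSpace ℝ (Fin d)),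
        (∀ x y, ‖T x - T y‖ ≤ ‖x - y‖) →
      ∀ (ystar : EuclideanSpace ℝ (Fin d)), T ystar = ystar →
      ∀ (y0 : EuclideanSpace ℝ (Fin d)) (y : ℕ → EuclideanSpace ℝ (Fin d)),
        y 0 = y0 →
        (∀ k, k < N - 1 →
          y (k + 1) = y k - ∑ j ∈ Finset.range (k + 1), H (k + 1) (j + 1) • (y j - T (y j))) →
        ‖y (N - 1) - T (y (N - 1))‖ ^ 2 ≤ 4 * ‖y0 - ystar‖ ^ 2 / (N : ℝ) ^ 2) ↔
    ((∀ m, 1 ≤ m → m ≤ N - 1 →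
        Pinv H (N - 1) m = 1 / (N : ℝ) * (Nat.choose N (m + 1) : ℝ)) ∧
      (∀ k j, 1 ≤ j → j < k → k ≤ N → 0 ≤ lamStar N H k j)) := by
  obtain ⟨n, rfl⟩ : ∃ n, N = n + 1 := ⟨N - 1, by omega⟩
  change IsExactOptimal H n ↔ _
  rw [Nat.add_sub_cancel]
  refine ⟨fun h => ⟨fun m _ hm => Pinv_eq_of_residualPoly_eq h.coeff_residualPoly hm,
    fun k j hj hjk hk => ?_⟩, fun ⟨hP, hlam⟩ => isExactOptimal_of_lamStar_nonneg (fun l hl => ?_)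
      fun k j hjk hk => hlam _ _ (by omega) (by omega) (by omega)⟩
  · obtain ⟨k, rfl⟩ : ∃ i, k = i + 1 := ⟨k - 1, by omega⟩
    obtain ⟨j, rfl⟩ : ∃ i, j = i + 1 := ⟨j - 1, by omega⟩
    exact h.lamStar_nonneg (by omega) (by omega)
  · rcases Nat.eq_zero_or_pos l with rfl | h0
    · rw [Pinv, zero_add, Nat.choose_one_right, one_div_mul_cancel (by positivity)]
    · exact hP l h0 hl
end

section
/- Let N ≥ 2 and let H be an H-matrix. Suppose that for every nonexpansive T : ℝ^N → ℝ^N with a fixed point y⋆ and every y₀ ∈ ℝ^N, the iterates of the H-matrix algorithm satisfy ‖y_{N−1} − T y_{N−1}‖² ≤ 4‖y₀ − y⋆‖²/N². Then P(N−1,m;H) = (1/N)·C(N,m+1) for all m = 1,…,N−1. -/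
open Finset

/-- The chains `1 ≤ j(1) ≤ i(1) < ⋯ < j(m) ≤ i(m) ≤ k`, as functions `r ↦ (i(r), j(r))`. -/
def hChains (k m : ℕ) : Finset (Fin m → ℕ × ℕ) :=
  (Fintype.piFinset fun _ : Fin m => range (k + 1) ×ˢ range (k + 1)).filter fun f =>
    (∀ r, 1 ≤ (f r).2 ∧ (f r).2 ≤ (f r).1) ∧ ∀ r s, r < s → (f r).1 < (f s).2

theorem mem_hChains {k m : ℕ} {f : Fin m → ℕ × ℕ} :
    f ∈ hChains k m ↔ (∀ r, (f r).1 ≤ k) ∧ (∀ r, 1 ≤ (f r).2 ∧ (f r).2 ≤ (f r).1) ∧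
      ∀ r s, r < s → (f r).1 < (f s).2 := by
  simp only [hChains, mem_filter, Fintype.mem_piFinset, mem_product, mem_range, Nat.lt_succ_iff]
  constructor
  · rintro ⟨h1, h2, h3⟩
    exact ⟨fun r => (h1 r).1, h2, h3⟩
  · rintro ⟨h1, h2, h3⟩
    exact ⟨fun r => ⟨h1 r, (h2 r).2.trans (h1 r)⟩, h2, h3⟩

/-- For chains it suffices to compare consecutive indices. -/
theorem chain_consecutive_iff {m : ℕ} {f : Fin (m + 1) → ℕ × ℕ}
    (hf : ∀ r, (f r).2 ≤ (f r).1) :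
    (∀ r : Fin m, (f r.castSucc).1 < (f r.succ).2) ↔ ∀ r s, r < s → (f r).1 < (f s).2 := by
  refine ⟨fun h r s hrs => ?_, fun h r => h _ _ Fin.castSucc_lt_succ⟩
  have hmono : StrictMono fun r => (f r).1 :=
    Fin.strictMono_iff_lt_succ.2 fun i => (h i).trans_le (hf _)
  obtain ⟨t, rfl⟩ := Fin.exists_succ_eq.2 (Fin.ne_zero_of_lt hrs)
  exact (hmono.monotone (Fin.le_castSucc_iff.2 hrs)).trans_lt (h t)

theorem Pinv_eq_sum_hChains (H : ℕ → ℕ → ℝ) (k m : ℕ) :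
    Pinv H k m = ∑ f ∈ hChains k m, ∏ r, H (f r).1 (f r).2 := by
  cases m with
  | zero =>
    have : hChains k 0 = {Fin.elim0} := by
      ext f
      simp [mem_hChains, Subsingleton.elim f Fin.elim0]
    simp [Pinv, this]
  | succ m =>
    rw [Pinv, ← sum_filter]
    refine sum_bij (fun f _ r => (((f r).1 : ℕ), ((f r).2 : ℕ))) ?_ ?_ ?_ ?_
    · intro f hf
      obtain ⟨h1, h2⟩ := (mem_filter.1 hf).2
      refine mem_hChains.2 ⟨fun r => Nat.lt_succ_iff.1 (f r).1.2, h1, ?_⟩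
      exact (chain_consecutive_iff (f := fun r => (((f r).1 : ℕ), ((f r).2 : ℕ)))
        fun r => (h1 r).2).1 h2
    · intro f _ g _ hfg
      funext r
      have := congrFun hfg r
      simp only [Prod.mk.injEq] at this
      exact Prod.ext (Fin.ext this.1) (Fin.ext this.2)
    · intro f hf
      obtain ⟨h1, h2, h3⟩ := mem_hChains.1 hf
      refine ⟨fun r => (⟨(f r).1, Nat.lt_succ_iff.2 (h1 r)⟩,
        ⟨(f r).2, Nat.lt_succ_iff.2 ((h2 r).2.trans (h1 r))⟩), ?_, rfl⟩
      exact mem_filter.2 ⟨mem_univ _, h2, (chain_consecutive_iff fun r => (h2 r).2).2 h3⟩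
    · intro f _
      rfl

theorem Pinv_succ_succ (H : ℕ → ℕ → ℝ) (k m : ℕ) :
    Pinv H (k + 1) (m + 1) =
      Pinv H k (m + 1) + ∑ j ∈ range (k + 1), H (k + 1) (j + 1) * Pinv H j m := by
  simp only [Pinv_eq_sum_hChains, mul_sum]
  rw [← sum_filter_add_sum_filter_not (hChains (k + 1) (m + 1))
    fun f => (f (Fin.last m)).1 ≤ k]
  congr 1
  · refine sum_congr ?_ fun _ _ => rfl
    ext f
    simp only [mem_filter, mem_hChains]
    constructor
    · rintro ⟨⟨-, h2, h3⟩, h4⟩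
      refine ⟨fun r => ?_, h2, h3⟩
      rcases (Fin.le_last r).eq_or_lt with rfl | hr
      · exact h4
      · have := h3 _ _ hr
        have := h2 (Fin.last m)
        omega
    · rintro ⟨h1, h2, h3⟩
      exact ⟨⟨fun r => (h1 r).trans k.le_succ, h2, h3⟩, h1 _⟩
  · rw [sum_sigma']
    symm
    refine sum_bij'
      (fun p _ => (Fin.snoc p.2 (k + 1, p.1 + 1) : Fin (m + 1) → ℕ × ℕ))
      (fun f _ => (⟨(f (Fin.last m)).2 - 1, fun r => f r.castSucc⟩ :
        Σ _ : ℕ, Fin m → ℕ × ℕ)) ?_ ?_ ?_ ?_ ?_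
    · rintro ⟨j, g⟩ hg
      obtain ⟨hj, hg⟩ := mem_sigma.1 hg
      obtain ⟨h1, h2, h3⟩ := mem_hChains.1 hg
      simp only [mem_range] at hj
      dsimp only at h1 h2 h3
      refine mem_filter.2 ⟨mem_hChains.2 ⟨?_, ?_, ?_⟩, by simp⟩
      · intro r
        refine Fin.lastCases (by simp) (fun r => ?_) r
        have := h1 r
        simp only [Fin.snoc_castSucc]
        omega
      · intro r
        refine Fin.lastCases ?_ (fun r => ?_) r
        · simp only [Fin.snoc_last]
          omega
        · simpa only [Fin.snoc_castSucc] using h2 r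
      · intro r s
        refine Fin.lastCases ?_ (fun r => ?_) r
        · intro h
          exact absurd h (Fin.le_last s).not_gt
        · refine Fin.lastCases ?_ (fun s => ?_) s
          · have := h1 r
            simp only [Fin.snoc_last, Fin.snoc_castSucc]
            omega
          · simpa only [Fin.snoc_castSucc, Fin.castSucc_lt_castSucc_iff] using h3 r s
    · intro f hf
      obtain ⟨hf, h4⟩ := mem_filter.1 hf
      obtain ⟨h1, h2, h3⟩ := mem_hChains.1 hf
      have hl := h1 (Fin.last m)
      have hl' := h2 (Fin.last m)
      refine mem_sigma.2 ⟨mem_range.2 (by dsimp only; omega), mem_hChains.2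
        ⟨fun r => ?_, fun r => h2 _, fun r s hrs => h3 _ _ (Fin.castSucc_lt_castSucc_iff.2 hrs)⟩⟩
      have := h3 _ _ (Fin.castSucc_lt_last r)
      dsimp only
      omega
    · rintro ⟨j, g⟩ _
      simp
    · intro f hf
      obtain ⟨hf, h4⟩ := mem_filter.1 hf
      obtain ⟨h1, h2, h3⟩ := mem_hChains.1 hf
      have hl := h1 (Fin.last m)
      have hl' := h2 (Fin.last m)
      funext r
      refine Fin.lastCases ?_ (fun r => ?_) r
      · simp only [Fin.snoc_last]
        exact Prod.ext (by dsimp only; omega) (by dsimp only; omega)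
      · simp only [Fin.snoc_castSucc]
    · rintro ⟨j, g⟩ _
      simp [Fin.prod_univ_castSucc, mul_comm]

theorem Pinv_zero_right (H : ℕ → ℕ → ℝ) (k : ℕ) : Pinv H k 0 = 1 := rfl

theorem Pinv_eq_zero_of_lt (H : ℕ → ℕ → ℝ) {k m : ℕ} (h : k < m) : Pinv H k m = 0 := by
  rw [Pinv_eq_sum_hChains]
  refine sum_eq_zero fun f hf => ?_
  obtain ⟨h1, h2, h3⟩ := mem_hChains.1 hf
  have hmono : StrictMono fun r => (f r).1 := fun r s hrs => (h3 r s hrs).trans_le (h2 s).2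
  have hpos : ∀ r : Fin m, (r : ℕ) + 1 ≤ (f r).1 := by
    rintro ⟨r, hr⟩
    induction r with
    | zero => exact (h2 _).1.trans (h2 _).2
    | succ r ih =>
      have := ih (by omega)
      have := hmono (show (⟨r, by omega⟩ : Fin m) < ⟨r + 1, hr⟩ from Nat.lt_succ_self r)
      dsimp only at *
      omega
  have := hpos ⟨k, h⟩
  have := h1 ⟨k, h⟩
  dsimp only at *
  omega

section IteratePolynomial

open Polynomial

/-- For linear `T`, the iterates are `y_k = q_k(1 - T) y₀`, where `q_k` is this polynomial. -/
noncomputable def iteratePoly (H : ℕ → ℕ → ℝ) (k : ℕ) : ℝ[X] :=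
  ∑ m ∈ range (k + 1), C ((-1) ^ m * Pinv H k m) * X ^ m

theorem coeff_iteratePoly (H : ℕ → ℕ → ℝ) (k m : ℕ) :
    (iteratePoly H k).coeff m = (-1) ^ m * Pinv H k m := by
  simp only [iteratePoly, finsetSum_coeff, coeff_C_mul_X_pow, sum_ite_eq, mem_range]
  split_ifs with h
  · rfl
  · rw [Pinv_eq_zero_of_lt H (by omega), mul_zero]

theorem natDegree_iteratePoly_le (H : ℕ → ℕ → ℝ) (k : ℕ) : (iteratePoly H k).natDegree ≤ k :=
  natDegree_le_iff_coeff_eq_zero.2 fun m hm => by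
    rw [coeff_iteratePoly, Pinv_eq_zero_of_lt H hm, mul_zero]

theorem iteratePoly_zero (H : ℕ → ℕ → ℝ) : iteratePoly H 0 = 1 := by
  simp [iteratePoly, Pinv_zero_right]

theorem iteratePoly_succ (H : ℕ → ℕ → ℝ) (k : ℕ) :
    iteratePoly H (k + 1) =
      iteratePoly H k - ∑ j ∈ range (k + 1), H (k + 1) (j + 1) • (X * iteratePoly H j) := by
  ext m
  simp only [coeff_sub, finsetSum_coeff, coeff_smul, smul_eq_mul]
  cases m with
  | zero => simp [coeff_iteratePoly, Pinv_zero_right]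
  | succ m =>
    simp only [coeff_X_mul, coeff_iteratePoly, Pinv_succ_succ, mul_add, mul_sum, sub_eq_add_neg,
      ← sum_neg_distrib]
    congr 1
    exact sum_congr rfl fun j _ => by ring

theorem iteratePoly_eval_zero (H : ℕ → ℕ → ℝ) (k : ℕ) : (iteratePoly H k).eval 0 = 1 := by
  rw [← coeff_zero_eq_eval_zero, coeff_iteratePoly, Pinv_zero_right, pow_zero, mul_one]

/-- If `p(1 - X)` is the average of `1, X, …, X^n`, then the coefficients of `p` are
signed binomial coefficients. -/
theorem coeff_of_comp_one_sub_X {p : ℝ[X]} {n : ℕ}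
    (hp : p.comp (1 - X) = C (1 / (n + 1 : ℝ)) * ∑ k ∈ range (n + 1), X ^ k) (m : ℕ) :
    p.coeff m = (-1) ^ m * (1 / (n + 1 : ℝ) * (n + 1).choose (m + 1)) := by
  have hp' : p = C (1 / (n + 1 : ℝ)) * ∑ k ∈ range (n + 1), (1 - X) ^ k := by
    have := congrArg (fun q : ℝ[X] => q.comp (1 - X)) hp
    simpa [comp_assoc] using this
  have hX : X * p = C (1 / (n + 1 : ℝ)) * (1 - (1 - X) ^ (n + 1)) := by
    rw [hp', ← mul_neg_geom_sum (1 - X : ℝ[X]) (n + 1)]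
    ring
  have hneg : (1 - X : ℝ[X]) ^ (n + 1) = ((1 + X) ^ (n + 1)).comp (C (-1) * X) := by
    simp [sub_eq_add_neg]
  have := congrArg (fun q : ℝ[X] => q.coeff (m + 1)) hX
  simp only [coeff_X_mul, coeff_C_mul, coeff_sub, hneg, comp_C_mul_X_coeff,
    coeff_one_add_X_pow, coeff_one] at this
  rw [this]
  simp
  ring

end IteratePolynomial

section NegacyclicShift

/-- The negacyclic shift `(x₀, …, x_n) ↦ (-x_n, x₀, …, x_{n-1})`. -/
noncomputable def negacyclicShift (n : ℕ) :
    EuclideanSpace ℝ (Fin (n + 1)) →ₗ[ℝ] EuclideanSpace ℝ (Fin (n + 1)) where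
  toFun x := WithLp.toLp 2 (Fin.cons (-x (Fin.last n)) fun i => x i.castSucc)
  map_add' x y := by
    ext i
    refine Fin.cases ?_ (fun i => ?_) i
    · simp [add_comm]
    · simp
  map_smul' c x := by
    ext i
    refine Fin.cases ?_ (fun i => ?_) i <;> simp

theorem negacyclicShift_zero (n : ℕ) (x : EuclideanSpace ℝ (Fin (n + 1))) :
    negacyclicShift n x 0 = -x (Fin.last n) := rfl

theorem negacyclicShift_succ (n : ℕ) (x : EuclideanSpace ℝ (Fin (n + 1))) (i : Fin n) :
    negacyclicShift n x i.succ = x i.castSucc := rfl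

theorem norm_negacyclicShift (n : ℕ) (x : EuclideanSpace ℝ (Fin (n + 1))) :
    ‖negacyclicShift n x‖ = ‖x‖ := by
  rw [EuclideanSpace.norm_eq, EuclideanSpace.norm_eq, Fin.sum_univ_succ, Fin.sum_univ_castSucc]
  simp only [negacyclicShift_zero, negacyclicShift_succ, norm_neg]
  rw [add_comm]

theorem negacyclicShift_pow_single (n : ℕ) (k : Fin (n + 1)) :
    (negacyclicShift n ^ (k : ℕ)) (EuclideanSpace.single 0 1) = EuclideanSpace.single k 1 := by
  refine Fin.induction ?_ (fun k ih => ?_) k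
  · simp
  · rw [Fin.val_succ, pow_succ', Module.End.mul_apply]
    rw [Fin.val_castSucc] at ih
    rw [ih]
    ext i
    refine Fin.cases ?_ (fun i => ?_) i
    · simp [negacyclicShift_zero, (Fin.castSucc_lt_last k).ne', (Fin.succ_ne_zero k).symm]
    · simp [negacyclicShift_succ]

theorem sub_negacyclicShift_ones (n : ℕ) :
    (1 - negacyclicShift n) (WithLp.toLp 2 fun _ => (1 : ℝ)) =
      (2 : ℝ) • EuclideanSpace.single 0 1 := by
  ext i
  refine Fin.cases ?_ (fun i => ?_) i
  · simp [negacyclicShift_zero]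
    norm_num
  · simp [negacyclicShift_succ]

theorem aeval_negacyclicShift_single {n : ℕ} {c : Polynomial ℝ} (hc : c.natDegree ≤ n)
    (i : Fin (n + 1)) :
    (Polynomial.aeval (negacyclicShift n) c (EuclideanSpace.single 0 1)) i = c.coeff i := by
  rw [Polynomial.aeval_eq_sum_range' (Nat.lt_succ_of_le hc), LinearMap.sum_apply,
    Finset.sum_range]
  simp [negacyclicShift_pow_single, Pi.single_apply]

end NegacyclicShift

/-- Equality case of Cauchy–Schwarz against the constant vector. -/
theorem eq_inv_card_of_sum_sq_le {ι : Type*} [Fintype ι] {c : ι → ℝ} (h1 : ∑ i, c i = 1)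
    (h2 : ∑ i, c i ^ 2 ≤ 1 / Fintype.card ι) (i : ι) : c i = 1 / Fintype.card ι := by
  have hpos : (Fintype.card ι : ℝ) ≠ 0 := by
    have : Nonempty ι := ⟨i⟩
    exact_mod_cast Fintype.card_ne_zero
  have hsum : ∑ i, (c i - 1 / Fintype.card ι) ^ 2 ≤ 0 := by
    have : ∑ i, (c i - 1 / Fintype.card ι) ^ 2 =
        ∑ i, c i ^ 2 - 2 / Fintype.card ι * ∑ i, c i + 1 / Fintype.card ι := by
      simp only [sub_sq, sum_add_distrib, sum_sub_distrib, mul_sum, sum_const, card_univ,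
        nsmul_eq_mul]
      congr 1
      · congr 1
        exact sum_congr rfl fun i _ => by ring
      · field_simp
    rw [this, h1]
    have : (2 : ℝ) / Fintype.card ι = 1 / Fintype.card ι + 1 / Fintype.card ι := by ring
    linarith
  have h0 := (sum_eq_zero_iff_of_nonneg fun i _ => sq_nonneg _).1
    (hsum.antisymm (sum_nonneg fun i _ => sq_nonneg (c i - 1 / Fintype.card ι))) i (mem_univ i)
  exact sub_eq_zero.1 (pow_eq_zero_iff two_ne_zero |>.1 h0)

/-- **Necessity of H-invariance for optimality (Theorem 4.1).**
If the H-matrix algorithm achieves the exact optimal worst-case rate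
`‖y_{N−1} − T y_{N−1}‖² ≤ 4‖y₀ − y⋆‖²/N²` for every nonexpansive `T : ℝ^N → ℝ^N` with a
fixed point, then `P(N−1,m;H) = (1/N)·C(N,m+1)` for `m = 1,…,N−1`. -/
theorem hinvariance_necessary (N : ℕ) (hN : 2 ≤ N) (H : ℕ → ℕ → ℝ)
    (hopt : ∀ (T : EuclideanSpace ℝ (Fin N) → EuclideanSpace ℝ (Fin N)),
        (∀ x y, ‖T x - T y‖ ≤ ‖x - y‖) →
      ∀ (ystar : EuclideanSpace ℝ (Fin N)), T ystar = ystar →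
      ∀ (y0 : EuclideanSpace ℝ (Fin N)) (y : ℕ → EuclideanSpace ℝ (Fin N)),
        y 0 = y0 →
        (∀ k, k < N - 1 →
          y (k + 1) = y k - ∑ j ∈ Finset.range (k + 1), H (k + 1) (j + 1) • (y j - T (y j))) →
        ‖y (N - 1) - T (y (N - 1))‖ ^ 2 ≤ 4 * ‖y0 - ystar‖ ^ 2 / (N : ℝ) ^ 2) :
    ∀ m, 1 ≤ m → m ≤ N - 1 →
      Pinv H (N - 1) m = 1 / (N : ℝ) * (Nat.choose N (m + 1) : ℝ) := by
  obtain ⟨n, rfl⟩ : ∃ n, N = n + 1 := ⟨N - 1, by omega⟩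
  intro m _ _
  simp only [Nat.add_sub_cancel] at hopt ⊢
  set T := negacyclicShift n
  set y0 : EuclideanSpace ℝ (Fin (n + 1)) := WithLp.toLp 2 fun _ => (1 : ℝ)
  set c : Polynomial ℝ := (iteratePoly H n).comp (1 - Polynomial.X) with hc
  have hdeg : c.natDegree ≤ n := by
    refine Polynomial.natDegree_comp_le.trans ?_
    have h1 : (1 - Polynomial.X : Polynomial ℝ).natDegree ≤ 1 := by compute_degree
    have h2 := natDegree_iteratePoly_le H n
    nlinarith
  have hbound := hopt T (fun x z => by rw [← map_sub, norm_negacyclicShift]) 0 (map_zero T) y0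
    (fun k => Polynomial.aeval (1 - T) (iteratePoly H k) y0) (by simp [iteratePoly_zero])
    (fun k _ => by simp [iteratePoly_succ])
  have hres : Polynomial.aeval (1 - T) (iteratePoly H n) y0 -
      T (Polynomial.aeval (1 - T) (iteratePoly H n) y0) =
      (2 : ℝ) • Polynomial.aeval T c (EuclideanSpace.single 0 1) := by
    have hcT : Polynomial.aeval T c = Polynomial.aeval (1 - T) (iteratePoly H n) := by
      simp [hc, Polynomial.aeval_comp]
    have hcomm : (1 - T) * Polynomial.aeval (1 - T) (iteratePoly H n) =
        Polynomial.aeval (1 - T) (iteratePoly H n) * (1 - T) := by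
      simpa using congrArg (Polynomial.aeval (1 - T))
        (mul_comm Polynomial.X (iteratePoly H n))
    rw [hcT, ← map_smul, ← sub_negacyclicShift_ones]
    exact congrArg (fun L : Module.End ℝ (EuclideanSpace ℝ (Fin (n + 1))) => L y0) hcomm
  have hsq : ∑ i : Fin (n + 1), c.coeff i ^ 2 ≤ 1 / Fintype.card (Fin (n + 1)) := by
    rw [hres, norm_smul, mul_pow, EuclideanSpace.real_norm_sq_eq, sub_zero,
      EuclideanSpace.real_norm_sq_eq] at hbound
    simp only [T, aeval_negacyclicShift_single hdeg] at hbound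
    have hN' : ((n + 1 : ℕ) : ℝ) ≠ 0 := by positivity
    have : 4 * (∑ i, y0 i ^ 2) / ((n + 1 : ℕ) : ℝ) ^ 2 = 4 * (1 / ((n + 1 : ℕ) : ℝ)) := by
      simp only [y0, one_pow, sum_const, card_univ, Fintype.card_fin, nsmul_eq_mul, mul_one]
      field_simp
    rw [this] at hbound
    rw [Fintype.card_fin]
    norm_num at hbound ⊢
    linarith
  have hone : ∑ i : Fin (n + 1), c.coeff i = 1 := by
    have : c.eval 1 = 1 := by simp [hc, Polynomial.eval_comp, iteratePoly_eval_zero]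
    rw [Polynomial.eval_eq_sum_range' (Nat.lt_succ_of_le hdeg), Finset.sum_range] at this
    simpa using this
  have hcoeff := eq_inv_card_of_sum_sq_le hone hsq
  have hcomp : c = Polynomial.C (1 / (n + 1 : ℝ)) * ∑ k ∈ range (n + 1), Polynomial.X ^ k := by
    rw [c.as_sum_range_C_mul_X_pow' (Nat.lt_succ_of_le hdeg), mul_sum]
    refine sum_congr rfl fun k hk => ?_
    have := hcoeff ⟨k, mem_range.1 hk⟩
    rw [Fintype.card_fin] at this
    push_cast at this
    rw [this]
  have := coeff_of_comp_one_sub_X hcomp m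
  rw [coeff_iteratePoly] at this
  push_cast
  exact mul_left_cancel₀ (pow_ne_zero m (by norm_num)) this
end
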